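/- arXiv:1403.7424 — 4 statements merged into one kernel-verified Lean document; each statement's English description precedes it below -/
import Mathlib

section
/- Let λ(k) = 4Σ_{j=1}^{4} sin²(πk_j) for k ∈ [0,1]^4, and for m² > 0 let B_{m²} = ∫_{[0,1]^4} (λ(k) + m²)^{−2} dk (the free bubble diagram in dimension 4). Then lim_{m²↓0} (16π² / log(1/m²)) · B_{m²} = 1; in particular B_{m²} ∼ log(m^{−2})/(16π²) as m² ↓ 0. -/
open MeasureTheory Filter Topology

noncomputable section

namespace Phi4

instance instNeZeroPowNat (L M : ℕ) [NeZero L] : NeZero (L ^ M) :=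
  ⟨pow_ne_zero M (NeZero.ne L)⟩

/-- The discrete `4`-dimensional torus of side length `L^N`. -/
abbrev Torus (L N : ℕ) := Fin 4 → ZMod (L ^ N)

/-- Spin field configurations: `n`-component fields on the torus. -/
abbrev Conf (L N n : ℕ) := Torus L N → Fin n → ℝ

/-- The unit lattice vector in direction `j`. -/
def unitVec (L N : ℕ) (j : Fin 4) : Torus L N := fun i => if i = j then 1 else 0

/-- The discrete Laplacian acting componentwise on fields. -/
def lap (L N n : ℕ) (φ : Conf L N n) (x : Torus L N) (i : Fin n) : ℝ :=
  ∑ j : Fin 4,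
    ((φ (x + unitVec L N j) i - φ x i) + (φ (x - unitVec L N j) i - φ x i))

/-- Squared Euclidean norm on `ℝ^n`. -/
def normSq {n : ℕ} (v : Fin n → ℝ) : ℝ := ∑ i, v i ^ 2

/-- The `|φ|⁴` Hamiltonian. -/
def ham (L N n : ℕ) [NeZero L] (g ν : ℝ) (φ : Conf L N n) : ℝ :=
  ∑ x : Torus L N,
    (g / 4 * normSq (φ x) ^ 2 + ν / 2 * normSq (φ x)
      + 1 / 2 * ∑ i : Fin n, φ x i * (-lap L N n φ x i))

/-- The partition function. -/
def partZ (L N n : ℕ) [NeZero L] (g ν : ℝ) : ℝ :=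
  ∫ φ : Conf L N n, Real.exp (-ham L N n g ν φ)

/-- Expectation with respect to the `|φ|⁴` measure. -/
def expect (L N n : ℕ) [NeZero L] (g ν : ℝ) (F : Conf L N n → ℝ) : ℝ :=
  (∫ φ : Conf L N n, F φ * Real.exp (-ham L N n g ν φ)) / partZ L N n g ν

/-- The `|φ|⁴` probability measure. -/
def gibbs (L N n : ℕ) [NeZero L] (g ν : ℝ) : Measure (Conf L N n) :=
  (ENNReal.ofReal (partZ L N n g ν))⁻¹ •
    volume.withDensity fun φ => ENNReal.ofReal (Real.exp (-ham L N n g ν φ))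

/-- The finite-volume two-point sum. -/
def corrSum (L N n : ℕ) [NeZero L] [NeZero n] (g ν : ℝ) : ℝ :=
  ∑ x : Torus L N, expect L N n g ν fun φ => φ 0 0 * φ x 0

/-- The finite-volume pressure. -/
def pressureN (L N n : ℕ) [NeZero L] (g ν : ℝ) : ℝ :=
  ((L : ℝ) ^ (4 * N))⁻¹ * Real.log (partZ L N n g ν)

/-- The Fourier multiplier of the lattice Laplacian on `ℤ^4`. -/
def lam (k : Fin 4 → ℝ) : ℝ := 4 * ∑ j : Fin 4, Real.sin (Real.pi * k j) ^ 2

/-- The unit cube `[0,1]^4`. -/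
def cube : Set (Fin 4 → ℝ) := Set.univ.pi fun _ => Set.Icc 0 1

/-- The free pressure `p(0, m²)`. -/
def freePressure (n : ℕ) (m2 : ℝ) : ℝ :=
  -(n : ℝ) * ∫ k in cube, Real.log (lam k + m2)

/-- The lattice Green function at the origin. -/
def green (m2 : ℝ) : ℝ := ∫ k in cube, (lam k + m2)⁻¹

/-- Embedding of the discrete torus into the continuum torus. -/
def embed (L N : ℕ) (x : Torus L N) : Fin 4 → ℝ :=
  fun j => ((x j).val : ℝ) / (L : ℝ) ^ N

/-- The pairing `φ⁽ᴺ⁾(h)` of a field with a test function. -/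
def pairing (L N n : ℕ) [NeZero L] (h : (Fin 4 → ℝ) → Fin n → ℝ) (φ : Conf L N n) : ℝ :=
  ∑ x : Torus L N, ∑ i : Fin n, h (embed L N x) i * φ x i

/-- `h : ℝ^4 → ℝ^n` is `ℤ^4`-periodic, i.e. a function on the continuum torus. -/
def IsPeriodic {n : ℕ} (h : (Fin 4 → ℝ) → Fin n → ℝ) : Prop :=
  ∀ (x : Fin 4 → ℝ) (j : Fin 4), h (fun i => x i + if i = j then 1 else 0) = h x

/-- The `L²(𝕋⁴, ℝⁿ)` inner product `(h, h)`. -/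
def pairL2 {n : ℕ} (h : (Fin 4 → ℝ) → Fin n → ℝ) : ℝ := ∫ x in cube, normSq (h x)

/-- Fourier coefficients of a test function on the torus. -/
def fourierCoeff {n : ℕ} (h : (Fin 4 → ℝ) → Fin n → ℝ) (l : Fin 4 → ℤ) (i : Fin n) : ℂ :=
  ∫ x in cube, (h x i : ℂ) *
    Complex.exp (-(2 * (Real.pi : ℂ) * Complex.I) * ∑ j : Fin 4, (l j : ℂ) * (x j : ℂ))

/-- The variance `(h, (−m⁻²Δ + 1)⁻¹ h)` of the massive Gaussian free field on the torus,
written via Fourier series. -/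
def gffVar {n : ℕ} (h : (Fin 4 → ℝ) → Fin n → ℝ) (m2 : ℝ) : ℝ :=
  ∑' l : Fin 4 → ℤ,
    (∑ i : Fin n, ‖fourierCoeff h l i‖ ^ 2) /
      (4 * Real.pi ^ 2 * m2⁻¹ * (∑ j : Fin 4, ((l j : ℝ)) ^ 2) + 1)

/-- The matrix of `−Δ` on the discrete torus. -/
def negLapMatrix (L N : ℕ) [NeZero L] : Matrix (Torus L N) (Torus L N) ℝ :=
  Matrix.of fun x y => ∑ j : Fin 4,
    (((if y = x then (1 : ℝ) else 0) - if y = x + unitVec L N j then 1 else 0)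
      + ((if y = x then (1 : ℝ) else 0) - if y = x - unitVec L N j then 1 else 0))

/-- Forward difference in direction `j` on the torus. -/
def fwdDiff (L N : ℕ) (j : Fin 4) (f : Torus L N → ℝ) : Torus L N → ℝ :=
  fun x => f (x + unitVec L N j) - f x

/-- Iterated forward differences `∇^α` on the torus. -/
def fwdDiffMulti (L N : ℕ) (α : Fin 4 → ℕ) (f : Torus L N → ℝ) : Torus L N → ℝ :=
  (fwdDiff L N 0)^[α 0] ((fwdDiff L N 1)^[α 1] ((fwdDiff L N 2)^[α 2] ((fwdDiff L N 3)^[α 3] f)))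

/-- Partial derivative in direction `j`. -/
def pderiv1 (j : Fin 4) (f : (Fin 4 → ℝ) → ℝ) : (Fin 4 → ℝ) → ℝ :=
  fun x => fderiv ℝ f x (Pi.single j 1)

/-- Iterated partial derivatives `∂^β`. -/
def pderivMulti (β : Fin 4 → ℕ) (f : (Fin 4 → ℝ) → ℝ) : (Fin 4 → ℝ) → ℝ :=
  (pderiv1 0)^[β 0] ((pderiv1 1)^[β 1] ((pderiv1 2)^[β 2] ((pderiv1 3)^[β 3] f)))

/-- The lattice `ℤ^4`. -/
abbrev Zd := Fin 4 → ℤ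

/-- Forward difference in direction `j` on `ℤ^4`. -/
def fwdZ (j : Fin 4) (f : Zd → ℝ) : Zd → ℝ := fun x => f (x + Pi.single j 1) - f x

/-- Iterated forward differences `∇^α` on `ℤ^4`. -/
def fwdZMulti (α : Fin 4 → ℕ) (f : Zd → ℝ) : Zd → ℝ :=
  (fwdZ 0)^[α 0] ((fwdZ 1)^[α 1] ((fwdZ 2)^[α 2] ((fwdZ 3)^[α 3] f)))

/-- Euclidean norm on `ℤ^4`. -/
def eNorm (x : Zd) : ℝ := Real.sqrt (∑ j : Fin 4, ((x j : ℝ)) ^ 2)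

/-- `(ΔC)₀ = Σ_{|e|₁=1} (C_e − C_0)`. -/
def lapZ0 (C : Zd → ℝ) : ℝ :=
  ∑ j : Fin 4, ((C (Pi.single j 1) - C 0) + (C (-Pi.single j 1) - C 0))

/-- The rescaled Green quadratic form `m² L^{−4N} (h_N, (−Δ+m²)⁻¹ h_N)`. -/
def quadForm (L N n : ℕ) [NeZero L] (m2 : ℝ) (h : (Fin 4 → ℝ) → Fin n → ℝ) : ℝ :=
  m2 * ((L : ℝ) ^ (4 * N))⁻¹ *
    ∑ x : Torus L N, ∑ y : Torus L N, ∑ i : Fin n,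
      h (embed L N x) i *
        ((negLapMatrix L N + m2 • (1 : Matrix (Torus L N) (Torus L N) ℝ))⁻¹ x y) *
        h (embed L N y) i


/-- The one-dimensional heat kernel `e^{tΔ}(0, 0)` on `ℤ`, as a Fourier integral. -/
def heatKernel (t : ℝ) : ℝ :=
  ∫ x in Set.Icc (0 : ℝ) 1, Real.exp (-(t * (4 * Real.sin (Real.pi * x) ^ 2)))

lemma heatKernel_nonneg (t : ℝ) : 0 ≤ heatKernel t :=
  integral_nonneg fun _ => (Real.exp_pos _).le

lemma measurable_heatKernel : Measurable heatKernel := by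
  have h : StronglyMeasurable (fun p : ℝ × ℝ =>
      Real.exp (-(p.1 * (4 * Real.sin (Real.pi * p.2) ^ 2)))) :=
    Continuous.stronglyMeasurable (by fun_prop)
  exact (h.integral_prod_right' (ν := volume.restrict (Set.Icc (0 : ℝ) 1))).measurable

lemma heatKernel_le_one {t : ℝ} (ht : 0 ≤ t) : heatKernel t ≤ 1 := by
  have h : ∀ x : ℝ, Real.exp (-(t * (4 * Real.sin (Real.pi * x) ^ 2))) ≤ 1 := fun x =>
    Real.exp_le_one_iff.2 (neg_nonpos.2 (by positivity))
  calc heatKernel t ≤ ∫ _ in Set.Icc (0 : ℝ) 1, (1 : ℝ) := by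
        refine integral_mono_of_nonneg (ae_of_all _ fun _ => (Real.exp_pos _).le)
          (integrable_const _) (ae_of_all _ h)
    _ = 1 := by simp

lemma sqrt_mul_heatKernel {t : ℝ} (ht : 0 < t) :
    √t * heatKernel t = ∫ y, (Set.Ioc (-(√t / 2)) (√t / 2)).indicator
      (fun y => Real.exp (-(t * (4 * Real.sin (Real.pi * (y / √t)) ^ 2)))) y := by
  have hs : 0 < √t := Real.sqrt_pos.2 ht
  have hper : Function.Periodic
      (fun x : ℝ => Real.exp (-(t * (4 * Real.sin (Real.pi * x) ^ 2)))) 1 := fun x => by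
    simp only [mul_add, mul_one, Real.sin_add_pi, neg_sq]
  have h1 := hper.intervalIntegral_add_eq 0 (-(1 / 2))
  have h2 := intervalIntegral.integral_comp_div (a := -(√t / 2)) (b := √t / 2)
    (fun x : ℝ => Real.exp (-(t * (4 * Real.sin (Real.pi * x) ^ 2)))) hs.ne'
  rw [show -(√t / 2) / √t = -(1 / 2) by field_simp,
    show √t / 2 / √t = -(1 / 2) + 1 by field_simp; norm_num, ← h1, zero_add, smul_eq_mul,
    intervalIntegral.integral_of_le (by linarith),
    intervalIntegral.integral_of_le zero_le_one] at h2
  rw [integral_indicator measurableSet_Ioc, h2, heatKernel, integral_Icc_eq_integral_Ioc]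

lemma heatKernel_integrand_le {t : ℝ} (ht : 0 < t) (y : ℝ) :
    (Set.Ioc (-(√t / 2)) (√t / 2)).indicator
      (fun y => Real.exp (-(t * (4 * Real.sin (Real.pi * (y / √t)) ^ 2)))) y
      ≤ Real.exp (-16 * y ^ 2) := by
  have hs : 0 < √t := Real.sqrt_pos.2 ht
  refine Set.indicator_apply_le' (fun hy => Real.exp_le_exp.2 ?_) fun _ => (Real.exp_pos _).le
  have hy' : |y / √t| ≤ 1 / 2 := by
    rw [abs_div, abs_of_pos hs, div_le_iff₀ hs]
    exact abs_le.2 ⟨by linarith [hy.1], by linarith [hy.2]⟩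
  have hpi := Real.pi_pos
  have h := Real.mul_abs_le_abs_sin (x := Real.pi * (y / √t)) (by
    rw [abs_mul, abs_of_pos hpi]; nlinarith)
  rw [abs_mul, abs_of_pos hpi, ← mul_assoc, div_mul_cancel₀ _ hpi.ne'] at h
  have h2 := pow_le_pow_left₀ (by positivity) h 2
  rw [mul_pow, sq_abs, sq_abs, div_pow, Real.sq_sqrt ht.le] at h2
  have h3 := mul_le_mul_of_nonneg_left h2 ht.le
  rw [show t * (2 ^ 2 * (y ^ 2 / t)) = 4 * y ^ 2 by field_simp; ring] at h3
  linarith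

lemma integrable_exp_neg_sixteen_mul_sq : Integrable fun y : ℝ => Real.exp (-16 * y ^ 2) :=
  integrable_exp_neg_mul_sq (by norm_num)

lemma sqrt_mul_heatKernel_le_one {t : ℝ} (ht : 0 < t) : √t * heatKernel t ≤ 1 := by
  rw [sqrt_mul_heatKernel ht]
  calc _ ≤ ∫ y, Real.exp (-16 * y ^ 2) :=
        integral_mono_of_nonneg
          (ae_of_all _ fun y => Set.indicator_nonneg (fun _ _ => (Real.exp_pos _).le) y)
          integrable_exp_neg_sixteen_mul_sq (ae_of_all _ (heatKernel_integrand_le ht))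
    _ = √(Real.pi / 16) := integral_gaussian 16
    _ ≤ 1 := Real.sqrt_le_one.2 (by linarith [Real.pi_le_four])

lemma tendsto_mul_sin_div (a : ℝ) :
    Tendsto (fun s : ℝ => s * Real.sin (a / s)) atTop (𝓝 a) := by
  have h : HasDerivAt (fun h : ℝ => Real.sin (a * h)) a 0 := by
    simpa using ((hasDerivAt_id (0 : ℝ)).const_mul a).sin
  have h2 := h.tendsto_slope_zero_right.comp tendsto_inv_atTop_nhdsGT_zero
  simpa [Function.comp_def, div_eq_mul_inv] using h2

lemma tendsto_sqrt_mul_heatKernel :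
    Tendsto (fun t => √t * heatKernel t) atTop (𝓝 √(Real.pi / (4 * Real.pi ^ 2))) := by
  rw [← integral_gaussian]
  have key : Tendsto (fun t : ℝ => ∫ y, (Set.Ioc (-(√t / 2)) (√t / 2)).indicator
      (fun y => Real.exp (-(t * (4 * Real.sin (Real.pi * (y / √t)) ^ 2)))) y) atTop
      (𝓝 (∫ y : ℝ, Real.exp (-(4 * Real.pi ^ 2) * y ^ 2))) := by
    refine tendsto_integral_filter_of_dominated_convergence (fun y => Real.exp (-16 * y ^ 2))
      ?_ ?_ integrable_exp_neg_sixteen_mul_sq ?_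
    · refine Eventually.of_forall fun t => ?_
      refine Measurable.aestronglyMeasurable (Measurable.indicator ?_ measurableSet_Ioc)
      fun_prop
    · filter_upwards [eventually_gt_atTop 0] with t ht
      refine ae_of_all _ fun y => ?_
      rw [Real.norm_of_nonneg (Set.indicator_nonneg (fun _ _ => (Real.exp_pos _).le) y)]
      exact heatKernel_integrand_le ht y
    · refine ae_of_all _ fun y => ?_
      have hlim : Tendsto (fun t : ℝ => Real.exp (-(4 *
          (√t * Real.sin (Real.pi * y / √t)) ^ 2))) atTop
          (𝓝 (Real.exp (-(4 * Real.pi ^ 2) * y ^ 2))) := by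
        have := (((tendsto_mul_sin_div (Real.pi * y)).comp
          Real.tendsto_sqrt_atTop).pow 2).const_mul 4
        rw [show -(4 * Real.pi ^ 2) * y ^ 2 = -(4 * (Real.pi * y) ^ 2) by ring]
        exact (Real.continuous_exp.tendsto _).comp this.neg
      refine hlim.congr' ?_
      filter_upwards [eventually_gt_atTop 0,
        Real.tendsto_sqrt_atTop.eventually_gt_atTop (2 * |y|)] with t ht hty
      rw [Set.indicator_of_mem]
      · rw [mul_pow, Real.sq_sqrt ht.le, mul_div_assoc]
        ring_nf
      · have := abs_lt.1 (show |y| < √t / 2 by linarith)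
        exact ⟨this.1, this.2.le⟩
  refine key.congr' ?_
  filter_upwards [eventually_gt_atTop 0] with t ht
  exact (sqrt_mul_heatKernel ht).symm

lemma sq_mul_heatKernel_pow_four {t : ℝ} (ht : 0 ≤ t) :
    t ^ 2 * heatKernel t ^ 4 = (√t * heatKernel t) ^ 4 := by
  rw [mul_pow, show √t ^ 4 = (√t ^ 2) ^ 2 by ring, Real.sq_sqrt ht]

lemma tendsto_sq_mul_heatKernel_pow_four :
    Tendsto (fun t => t ^ 2 * heatKernel t ^ 4) atTop (𝓝 (1 / (16 * Real.pi ^ 2))) := by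
  have h := tendsto_sqrt_mul_heatKernel.pow 4
  rw [show √(Real.pi / (4 * Real.pi ^ 2)) ^ 4 = 1 / (16 * Real.pi ^ 2) by
    rw [show ∀ x : ℝ, x ^ 4 = (x ^ 2) ^ 2 by intro x; ring, Real.sq_sqrt (by positivity)]
    have := Real.pi_pos
    field_simp
    norm_num] at h
  refine h.congr' ?_
  filter_upwards [eventually_ge_atTop 0] with t ht
  exact (sq_mul_heatKernel_pow_four ht).symm

lemma integrable_exp_one_sub_abs : Integrable fun u : ℝ => Real.exp (1 - |u|) := by
  rw [← integrableOn_univ, ← Set.Iic_union_Ioi (a := (0 : ℝ))]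
  refine IntegrableOn.union ?_ ?_
  · refine IntegrableOn.congr_fun ((integrableOn_exp_Iic 0).const_mul (Real.exp 1))
      (fun u hu => ?_) measurableSet_Iic
    simp only [abs_of_nonpos (Set.mem_Iic.1 hu), ← Real.exp_add, sub_neg_eq_add]
  · refine IntegrableOn.congr_fun ((integrableOn_exp_neg_Ioi 0).const_mul (Real.exp 1))
      (fun u hu => ?_) measurableSet_Ioi
    simp only [abs_of_pos (Set.mem_Ioi.1 hu), ← Real.exp_add, sub_eq_add_neg]

lemma integral_Ioi_eq_mul_integral_exp {L : ℝ} (hL : 0 < L) (g : ℝ → ℝ) :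
    ∫ t in Set.Ioi (0 : ℝ), g t / t = L * ∫ u, g (Real.exp (L * u)) := by
  have himg : (fun u : ℝ => Real.exp (L * u)) '' Set.univ = Set.Ioi 0 := by
    ext t
    simp only [Set.mem_image, Set.mem_univ, true_and, Set.mem_Ioi]
    refine ⟨?_, fun ht => ⟨Real.log t / L, ?_⟩⟩
    · rintro ⟨u, rfl⟩
      exact Real.exp_pos _
    · rw [mul_div_cancel₀ _ hL.ne', Real.exp_log ht]
  rw [← himg, integral_image_eq_integral_abs_deriv_smul (f' := fun u => Real.exp (L * u) * L)
    MeasurableSet.univ, setIntegral_univ, ← integral_const_mul]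
  · congr 1 with u
    have := Real.exp_pos (L * u)
    rw [abs_of_pos (by positivity), smul_eq_mul]
    field_simp
  · intro u _
    simpa using ((hasDerivAt_id u).const_mul L).exp
  · intro u _ v _ h
    exact mul_left_cancel₀ hL.ne' (Real.exp_injective h)

/-- A function that is `O(t²)` at `0` and tends to `c` at infinity has truncated logarithmic
integral `∫ G(t) e^{-mt} dt/t ∼ c log (1/m)` as `m ↓ 0`. -/
lemma tendsto_integral_div_log {G : ℝ → ℝ} {c : ℝ} (hG : Measurable G)
    (h0 : ∀ t, 0 < t → 0 ≤ G t) (h1 : ∀ t, 0 < t → G t ≤ 1) (h2 : ∀ t, 0 < t → G t ≤ t ^ 2)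
    (hc : Tendsto G atTop (𝓝 c)) :
    Tendsto (fun m : ℝ => (Real.log (1 / m))⁻¹ *
      ∫ t in Set.Ioi (0 : ℝ), G t * Real.exp (-(m * t)) / t) (𝓝[>] 0) (𝓝 c) := by
  have key : Tendsto (fun L : ℝ => ∫ u : ℝ, G (Real.exp (L * u)) *
      Real.exp (-Real.exp (L * (u - 1)))) atTop
      (𝓝 (∫ u : ℝ, (Set.Ioo (0 : ℝ) 1).indicator (fun _ => c) u)) := by
    refine tendsto_integral_filter_of_dominated_convergence (fun u => Real.exp (1 - |u|))
      ?_ ?_ integrable_exp_one_sub_abs ?_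
    · refine Eventually.of_forall fun L => Measurable.aestronglyMeasurable ?_
      exact (hG.comp (by fun_prop)).mul (by fun_prop)
    · filter_upwards [eventually_ge_atTop 1] with L hL
      refine ae_of_all _ fun u => ?_
      have hp := Real.exp_pos (L * u)
      have hE : Real.exp (-Real.exp (L * (u - 1))) ≤ 1 :=
        Real.exp_le_one_iff.2 (neg_nonpos.2 (Real.exp_pos _).le)
      rw [Real.norm_of_nonneg (mul_nonneg (h0 _ hp) (Real.exp_pos _).le)]
      rcases le_total u 0 with hu | hu
      · rw [abs_of_nonpos hu]
        calc _ ≤ G (Real.exp (L * u)) := mul_le_of_le_one_right (h0 _ hp) hE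
          _ ≤ Real.exp (L * u) ^ 2 := h2 _ hp
          _ = Real.exp (2 * (L * u)) := by rw [two_mul, Real.exp_add, sq]
          _ ≤ _ := Real.exp_le_exp.2 (by nlinarith)
      · rw [abs_of_nonneg hu]
        calc _ ≤ Real.exp (-Real.exp (L * (u - 1))) :=
              mul_le_of_le_one_left (Real.exp_pos _).le (h1 _ hp)
          _ ≤ _ := by
            rcases le_total u 1 with hu1 | hu1
            · exact hE.trans (Real.one_le_exp (by linarith))
            · refine Real.exp_le_exp.2 ?_
              have := Real.add_one_le_exp (L * (u - 1))
              nlinarith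
    · have hne : ∀ᵐ u : ℝ, u ≠ 0 ∧ u ≠ 1 :=
        (Measure.ae_ne volume 0).and (Measure.ae_ne volume 1)
      filter_upwards [hne] with u ⟨hu0, hu1⟩
      have hpos : ∀ {v : ℝ}, 0 < v → Tendsto (fun L : ℝ => Real.exp (L * v)) atTop atTop :=
        fun hv => Real.tendsto_exp_atTop.comp (tendsto_id.atTop_mul_const hv)
      have hneg : ∀ {v : ℝ}, v < 0 → Tendsto (fun L : ℝ => Real.exp (L * v)) atTop (𝓝 0) :=
        fun hv => Real.tendsto_exp_atBot.comp (tendsto_id.atTop_mul_const_of_neg hv)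
      rcases lt_or_gt_of_ne hu0 with hu | hu
      · rw [Set.indicator_of_notMem (fun h => absurd h.1 (by linarith))]
        have hsq := (hneg hu).pow 2
        rw [zero_pow two_ne_zero] at hsq
        refine squeeze_zero (fun L => mul_nonneg (h0 _ (Real.exp_pos _)) (Real.exp_pos _).le)
          (fun L => ?_) hsq
        exact (mul_le_of_le_one_right (h0 _ (Real.exp_pos _))
          (Real.exp_le_one_iff.2 (neg_nonpos.2 (Real.exp_pos _).le))).trans
          (h2 _ (Real.exp_pos _))
      · have hGu := hc.comp (hpos hu)
        rcases lt_or_gt_of_ne hu1 with hv | hv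
        · rw [Set.indicator_of_mem (show u ∈ Set.Ioo (0 : ℝ) 1 from ⟨hu, hv⟩)]
          have h := (Real.continuous_exp.tendsto _).comp (hneg (sub_neg.2 hv)).neg
          simpa using hGu.mul h
        · rw [Set.indicator_of_notMem (fun h => absurd h.2 (by linarith))]
          have h := Real.tendsto_exp_neg_atTop_nhds_zero.comp (hpos (sub_pos.2 hv))
          simpa using hGu.mul h
  rw [integral_indicator measurableSet_Ioo] at key
  simp only [integral_const, MeasurableSet.univ, measureReal_restrict_apply, Set.univ_inter,
    Real.volume_real_Ioo, sub_zero, smul_eq_mul, max_eq_left zero_le_one, one_mul] at key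
  have hlog : Tendsto (fun m : ℝ => Real.log (1 / m)) (𝓝[>] 0) atTop := by
    simp only [one_div]
    exact Real.tendsto_log_atTop.comp tendsto_inv_nhdsGT_zero
  refine (key.comp hlog).congr' ?_
  filter_upwards [hlog.eventually_gt_atTop 0, self_mem_nhdsWithin] with m hL hm
  rw [integral_Ioi_eq_mul_integral_exp hL (fun t => G t * Real.exp (-(m * t))),
    inv_mul_cancel_left₀ hL.ne']
  simp only [Function.comp_apply]
  congr 1 with u
  rw [mul_sub, mul_one, Real.exp_sub, Real.exp_log (one_div_pos.2 hm), one_div, div_inv_eq_mul,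
    mul_comm m]

lemma lam_nonneg (k : Fin 4 → ℝ) : 0 ≤ lam k := by
  unfold lam
  positivity

lemma continuous_lam : Continuous lam := by
  unfold lam
  fun_prop

lemma volume_cube_ne_top : volume cube ≠ ⊤ :=
  (isCompact_univ_pi fun _ => isCompact_Icc).measure_lt_top.ne

lemma integral_cube_exp_neg_mul_lam (t : ℝ) :
    ∫ k in cube, Real.exp (-(t * lam k)) = heatKernel t ^ 4 := by
  have h : ∀ k, Real.exp (-(t * lam k)) =
      ∏ j : Fin 4, Real.exp (-(t * (4 * Real.sin (Real.pi * k j) ^ 2))) := fun k => by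
    rw [← Real.exp_sum, lam, Finset.mul_sum, Finset.mul_sum, Finset.sum_neg_distrib]
  simp only [h]
  rw [cube, volume_pi, Measure.restrict_pi_pi,
    integral_fintype_prod_eq_pow (fun x : ℝ => Real.exp (-(t * (4 * Real.sin (Real.pi * x) ^ 2)))),
    Fintype.card_fin, heatKernel]

lemma integral_mul_exp_neg_mul_Ioi {a : ℝ} (ha : 0 < a) :
    ∫ t in Set.Ioi (0 : ℝ), t * Real.exp (-(a * t)) = (a ^ 2)⁻¹ := by
  have h := Real.integral_rpow_mul_exp_neg_mul_Ioi two_pos ha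
  norm_num [Real.Gamma_two] at h
  exact h

lemma integrableOn_mul_exp_neg_mul_Ioi {a : ℝ} (ha : 0 < a) :
    IntegrableOn (fun t : ℝ => t * Real.exp (-(a * t))) (Set.Ioi 0) := by
  refine Integrable.of_integral_ne_zero ?_
  rw [integral_mul_exp_neg_mul_Ioi ha]
  positivity

/-- The bubble diagram as a Laplace transform of the heat kernel. -/
lemma integral_cube_inv_sq {m : ℝ} (hm : 0 < m) :
    ∫ k in cube, ((lam k + m) ^ 2)⁻¹ =
      ∫ t in Set.Ioi (0 : ℝ), t ^ 2 * heatKernel t ^ 4 * Real.exp (-(m * t)) / t := by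
  have : IsFiniteMeasure (volume.restrict cube) :=
    ⟨by simpa using volume_cube_ne_top.lt_top⟩
  have hint : Integrable (Function.uncurry fun (k : Fin 4 → ℝ) (t : ℝ) =>
      t * Real.exp (-((lam k + m) * t)))
      ((volume.restrict cube).prod (volume.restrict (Set.Ioi 0))) := by
    have hb := (integrable_const (μ := volume.restrict cube) (1 : ℝ)).mul_prod
      (integrableOn_mul_exp_neg_mul_Ioi hm)
    refine hb.mono' (Continuous.aestronglyMeasurable ?_) ?_
    · have := continuous_lam
      unfold Function.uncurry
      fun_prop
    · have hae : ∀ᵐ p : (Fin 4 → ℝ) × ℝ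
          ∂((volume.restrict cube).prod (volume.restrict (Set.Ioi (0 : ℝ)))), 0 < p.2 :=
        Measure.quasiMeasurePreserving_snd.ae (ae_restrict_mem measurableSet_Ioi)
      filter_upwards [hae] with p hp
      simp only [Function.uncurry, one_mul]
      rw [Real.norm_of_nonneg (by positivity)]
      have := lam_nonneg p.1
      gcongr
      linarith
  calc _ = ∫ k in cube, ∫ t in Set.Ioi (0 : ℝ), t * Real.exp (-((lam k + m) * t)) := by
        congr 1 with k
        exact (integral_mul_exp_neg_mul_Ioi (by linarith [lam_nonneg k])).symm
    _ = ∫ t in Set.Ioi (0 : ℝ), ∫ k in cube, t * Real.exp (-((lam k + m) * t)) :=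
        integral_integral_swap hint
    _ = _ := by
        refine setIntegral_congr_fun measurableSet_Ioi fun t ht => ?_
        have ht' : t ≠ 0 := (Set.mem_Ioi.1 ht).ne'
        have h : ∀ k, t * Real.exp (-((lam k + m) * t)) =
            t * Real.exp (-(m * t)) * Real.exp (-(t * lam k)) := fun k => by
          rw [mul_assoc, ← Real.exp_add]
          ring_nf
        simp only [h, integral_const_mul, integral_cube_exp_neg_mul_lam]
        field_simp

/-- the free bubble diagram in dimension 4 satisfies
`B_{m²} ~ log(m⁻²)/(16π²)` as `m² ↓ 0`. -/
theorem bubble_diagram_asymptotics :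
    Tendsto (fun m2 : ℝ =>
        16 * Real.pi ^ 2 / Real.log (1 / m2) * ∫ k in cube, ((lam k + m2) ^ 2)⁻¹)
      (𝓝[>] (0 : ℝ)) (𝓝 1) := by
  have h := tendsto_integral_div_log (G := fun t => t ^ 2 * heatKernel t ^ 4)
    ((measurable_id.pow_const 2).mul (measurable_heatKernel.pow_const 4))
    (fun t _ => by have := heatKernel_nonneg t; positivity)
    (fun t ht => by
      rw [sq_mul_heatKernel_pow_four ht.le]
      exact pow_le_one₀ (mul_nonneg (Real.sqrt_nonneg t) (heatKernel_nonneg t))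
        (sqrt_mul_heatKernel_le_one ht))
    (fun t ht => mul_le_of_le_one_right (sq_nonneg t)
      (pow_le_one₀ (heatKernel_nonneg t) (heatKernel_le_one ht.le)))
    tendsto_sq_mul_heatKernel_pow_four
  have h' := h.const_mul (16 * Real.pi ^ 2)
  rw [mul_one_div_cancel (by positivity)] at h'
  refine h'.congr' ?_
  filter_upwards [self_mem_nhdsWithin] with m hm
  rw [integral_cube_inv_sq hm, div_eq_mul_inv (16 * Real.pi ^ 2), mul_assoc (16 * Real.pi ^ 2)]

end Phi4
end
end

section
/- Fix an integer L ≥ 2 and n ≥ 1. Let h ∈ C^∞(𝕋^4, ℝ^n), and for N ≥ 1 define h_N : Λ_N → ℝ^n by h_N(x) = h(L^{−N}x) under the identification of Λ_N with 𝕋^4_N. Let m_N² > 0 and let C^{(N)} = (−Δ_{Λ_N} + m_N²)^{−1}, the inverse of the positive-definite endomorphism −Δ_{Λ_N} + m_N² of ℝ^{Λ_N}, acting componentwise on ℝ^n-valued functions. Then: (a) if L^{2N} m_N² → m² ∈ (0,∞), then lim_{N→∞} m_N² L^{−4N} Σ_{x,y ∈ Λ_N} h_N(x)·(C^{(N)})_{x,y}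 h_N(y) = Σ_{l ∈ ℤ^4} |ĥ(l)|²/(4π² m^{−2}|l|² + 1); (b) if L^{2N} m_N² → ∞, then lim_{N→∞} m_N² L^{−4N} Σ_{x,y ∈ Λ_N} h_N(x)·(C^{(N)})_{x,y} h_N(y) = Σ_{i=1}^n ∫_{𝕋^4} h^i(x)² dx. -/
open MeasureTheory Filter Topology

noncomputable section

namespace Phi4

/-- The complexification of the matrix `−Δ + m²` on the discrete torus. -/
def massiveMatrix (L N : ℕ) [NeZero L] (m2 : ℝ) : Matrix (Torus L N) (Torus L N) ℂ :=
  (negLapMatrix L N + m2 • (1 : Matrix (Torus L N) (Torus L N) ℝ)).map Complex.ofRealHom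

/-- The complexification of the Green function `(−Δ + m²)⁻¹` on the discrete torus. -/
def greenMatrix (L N : ℕ) [NeZero L] (m2 : ℝ) : Matrix (Torus L N) (Torus L N) ℂ :=
  ((negLapMatrix L N + m2 • (1 : Matrix (Torus L N) (Torus L N) ℝ))⁻¹).map Complex.ofRealHom

lemma massiveMatrix_mulVec (L N : ℕ) [NeZero L] (m2 : ℝ) (u : Torus L N → ℂ) (x : Torus L N) :
    (massiveMatrix L N m2).mulVec u x =
      ∑ j : Fin 4, ((u x - u (x + unitVec L N j)) + (u x - u (x - unitVec L N j))) + m2 * u x := by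
  have hentry (y : Torus L N) : massiveMatrix L N m2 x y =
      ∑ j : Fin 4, (((if y = x then (1 : ℂ) else 0) - if y = x + unitVec L N j then 1 else 0)
        + ((if y = x then (1 : ℂ) else 0) - if y = x - unitVec L N j then 1 else 0))
      + m2 * (if y = x then 1 else 0) := by
    simp [massiveMatrix, negLapMatrix, Matrix.one_apply, eq_comm (a := x), apply_ite Complex.ofReal]
  simp only [Matrix.mulVec, dotProduct, hentry, add_mul, Finset.sum_add_distrib, Finset.sum_mul,
    sub_mul, ite_mul, one_mul, zero_mul, mul_ite, mul_one, mul_zero]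
  congr 1
  · rw [Finset.sum_comm, ← Finset.sum_add_distrib, Finset.sum_comm (s := Finset.univ (α := Torus L N)),
      ← Finset.sum_add_distrib]
    simp [Finset.sum_sub_distrib]
  · simp

/-- The maximum principle for `−Δ + m²`. -/
lemma norm_le_of_massiveMatrix_mulVec_le (L N : ℕ) [NeZero L] {m2 : ℝ} (u : Torus L N → ℂ)
    {c : ℝ} (hc : ∀ x, ‖(massiveMatrix L N m2).mulVec u x‖ ≤ c) (hm : 0 ≤ m2) (x : Torus L N) :
    m2 * ‖u x‖ ≤ c := by
  obtain ⟨z, -, hz⟩ := Finset.exists_max_image Finset.univ (fun y => ‖u y‖)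
    ⟨x, Finset.mem_univ x⟩
  have hmax (y : Torus L N) : ‖u y‖ ≤ ‖u z‖ := hz y (Finset.mem_univ y)
  have key : ((8 + m2 : ℝ) : ℂ) * u z = (massiveMatrix L N m2).mulVec u z +
      ∑ j : Fin 4, (u (z + unitVec L N j) + u (z - unitVec L N j)) := by
    rw [massiveMatrix_mulVec]
    simp only [Fin.sum_univ_four]
    push_cast
    ring
  have h1 : (8 + m2) * ‖u z‖ ≤ c + 8 * ‖u z‖ := by
    calc (8 + m2) * ‖u z‖ = ‖((8 + m2 : ℝ) : ℂ) * u z‖ := by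
          rw [norm_mul, Complex.norm_real, Real.norm_of_nonneg (by positivity)]
      _ ≤ c + ∑ _j : Fin 4, (‖u z‖ + ‖u z‖) := by
          rw [key]
          refine (norm_add_le _ _).trans (add_le_add (hc z) ((norm_sum_le _ _).trans ?_))
          exact Finset.sum_le_sum fun j _ =>
            (norm_add_le _ _).trans (add_le_add (hmax _) (hmax _))
      _ = c + 8 * ‖u z‖ := by simp; ring
  nlinarith [hmax x, mul_le_mul_of_nonneg_left (hmax x) hm]

lemma massiveMatrix_det_ne_zero (L N : ℕ) [NeZero L] {m2 : ℝ} (hm : 0 < m2) :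
    (massiveMatrix L N m2).det ≠ 0 := by
  intro h0
  obtain ⟨v, hv, hv0⟩ := Matrix.exists_mulVec_eq_zero_iff.mpr h0
  refine hv (funext fun x => ?_)
  have := norm_le_of_massiveMatrix_mulVec_le L N v (c := 0) (m2 := m2) (by simp [hv0]) hm.le x
  have h2 : ‖v x‖ ≤ 0 := by
    by_contra! hlt
    nlinarith [mul_pos hm hlt]
  simpa using h2

lemma isUnit_det_real (L N : ℕ) [NeZero L] {m2 : ℝ} (hm : 0 < m2) :
    IsUnit (negLapMatrix L N + m2 • (1 : Matrix (Torus L N) (Torus L N) ℝ)).det := by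
  rw [isUnit_iff_ne_zero]
  intro h0
  apply massiveMatrix_det_ne_zero L N hm
  have := RingHom.map_det Complex.ofRealHom
    (negLapMatrix L N + m2 • (1 : Matrix (Torus L N) (Torus L N) ℝ))
  rw [h0, map_zero] at this
  exact this.symm

lemma massiveMatrix_mul_greenMatrix (L N : ℕ) [NeZero L] {m2 : ℝ} (hm : 0 < m2) :
    massiveMatrix L N m2 * greenMatrix L N m2 = 1 := by
  rw [massiveMatrix, greenMatrix, ← Matrix.map_mul, Matrix.mul_nonsing_inv _ (isUnit_det_real L N hm)]
  simp

lemma greenMatrix_mul_massiveMatrix (L N : ℕ) [NeZero L] {m2 : ℝ} (hm : 0 < m2) :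
    greenMatrix L N m2 * massiveMatrix L N m2 = 1 := by
  rw [massiveMatrix, greenMatrix, ← Matrix.map_mul, Matrix.nonsing_inv_mul _ (isUnit_det_real L N hm)]
  simp

lemma norm_greenMatrix_mulVec_le (L N : ℕ) [NeZero L] {m2 : ℝ} (hm : 0 < m2) (u : Torus L N → ℂ)
    {c : ℝ} (hc : ∀ x, ‖u x‖ ≤ c) (x : Torus L N) :
    m2 * ‖(greenMatrix L N m2).mulVec u x‖ ≤ c := by
  refine norm_le_of_massiveMatrix_mulVec_le L N _ (fun y => ?_) hm.le x
  rw [Matrix.mulVec_mulVec, massiveMatrix_mul_greenMatrix L N hm, Matrix.one_mulVec]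
  exact hc y

/-- The embedding of the discrete torus into the continuum torus `(ℝ/ℤ)⁴`. -/
def torusPoint (L N : ℕ) [NeZero L] (x : Torus L N) : UnitAddTorus (Fin 4) :=
  fun j => ZMod.toAddCircle (x j)

lemma torusPoint_eq_embed (L N : ℕ) [NeZero L] (x : Torus L N) :
    torusPoint L N x = fun j => ((embed L N x j : ℝ) : UnitAddCircle) := by
  funext j
  simp [torusPoint, embed, ZMod.toAddCircle_apply]

/-- The factor picked up by a Fourier monomial of frequency `k` under translation by one lattice
spacing. -/
def phase (L N : ℕ) (k : ℤ) : ℂ :=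
  Complex.exp (2 * (Real.pi * ((k : ℝ) / (L : ℝ) ^ N) : ℝ) * Complex.I)

lemma phase_ne_zero (L N : ℕ) (k : ℤ) : phase L N k ≠ 0 := Complex.exp_ne_zero _

lemma two_sub_phase_sub_inv (L N : ℕ) (k : ℤ) :
    2 - phase L N k - (phase L N k)⁻¹ =
      (4 * Real.sin (Real.pi * ((k : ℝ) / (L : ℝ) ^ N)) ^ 2 : ℝ) := by
  set t : ℝ := Real.pi * ((k : ℝ) / (L : ℝ) ^ N) with ht
  have h1 : phase L N k + (phase L N k)⁻¹ = 2 * Complex.cos (2 * t) := by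
    rw [phase, ← Complex.exp_neg, ← neg_mul, Complex.cos]
    ring
  have h2 : Complex.cos (2 * t) = 1 - 2 * Complex.sin t ^ 2 := by
    rw [Complex.cos_two_mul, Complex.cos_sq']
    ring
  push_cast
  linear_combination -h1 - 2 * h2

lemma phase_ne_one (L N : ℕ) [NeZero L] {k : ℤ} (hk : k ≠ 0) (hkL : |k| < (L : ℤ) ^ N) :
    phase L N k ≠ 1 := by
  intro h
  rw [phase, Complex.exp_eq_one_iff] at h
  obtain ⟨n, hn⟩ := h
  have hL : (L : ℝ) ^ N ≠ 0 := pow_ne_zero _ (Nat.cast_ne_zero.mpr (NeZero.ne L))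
  have h1 : ((2 * (Real.pi * ((k : ℝ) / (L : ℝ) ^ N)) : ℝ) : ℂ) = ((n * (2 * Real.pi) : ℝ) : ℂ) := by
    refine mul_right_cancel₀ Complex.I_ne_zero ?_
    push_cast at hn ⊢
    linear_combination hn
  have h2 : (k : ℝ) = n * (L : ℝ) ^ N := by
    have h3 := Complex.ofReal_injective h1
    have h4 : (k : ℝ) / (L : ℝ) ^ N = n := by
      have := Real.pi_pos.ne'
      refine mul_left_cancel₀ (mul_ne_zero two_ne_zero this) ?_
      linear_combination h3
    rw [← h4, div_mul_cancel₀ _ hL]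
  have h3 : k = n * (L : ℤ) ^ N := by exact_mod_cast h2
  have hn0 : n ≠ 0 := by rintro rfl; exact hk (by simpa using h3)
  have hLpos : (0 : ℤ) ≤ (L : ℤ) ^ N := by positivity
  rw [h3, abs_mul, abs_of_nonneg hLpos] at hkL
  nlinarith [Int.one_le_abs hn0]

lemma mFourier_torusPoint_add_unitVec (L N : ℕ) [NeZero L] (l : Fin 4 → ℤ) (x : Torus L N)
    (j : Fin 4) :
    UnitAddTorus.mFourier l (torusPoint L N (x + unitVec L N j)) =
      phase L N (l j) * UnitAddTorus.mFourier l (torusPoint L N x) := by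
  have h (i : Fin 4) : fourier (l i) (torusPoint L N (x + unitVec L N j) i) =
      (if i = j then phase L N (l j) else 1) * fourier (l i) (torusPoint L N x i) := by
    have hadd : fourier (l i) (torusPoint L N (x + unitVec L N j) i) =
        fourier (l i) (torusPoint L N (unitVec L N j) i) * fourier (l i) (torusPoint L N x i) := by
      simp only [torusPoint, Pi.add_apply, map_add, fourier_apply, smul_add,
        AddCircle.toCircle_add, Circle.coe_mul]
      ring
    rw [hadd]
    congr 1
    split_ifs with hij
    · subst hij
      have : torusPoint L N (unitVec L N i) i = ((1 / (L : ℝ) ^ N : ℝ) : UnitAddCircle) := by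
        have := ZMod.toAddCircle_intCast (N := L ^ N) 1
        simpa [torusPoint, unitVec] using this
      rw [this, fourier_coe_apply, phase]
      congr 1
      push_cast
      ring
    · simp [torusPoint, unitVec, hij]
  simp only [UnitAddTorus.mFourier, ContinuousMap.coe_mk, h, Finset.prod_mul_distrib]
  simp

lemma mFourier_torusPoint_sub_unitVec (L N : ℕ) [NeZero L] (l : Fin 4 → ℤ) (x : Torus L N)
    (j : Fin 4) :
    UnitAddTorus.mFourier l (torusPoint L N (x - unitVec L N j)) =
      (phase L N (l j))⁻¹ * UnitAddTorus.mFourier l (torusPoint L N x) := by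
  have h := mFourier_torusPoint_add_unitVec L N l (x - unitVec L N j) j
  rw [sub_add_cancel] at h
  rw [h, inv_mul_cancel_left₀ (phase_ne_zero L N _)]

/-- The eigenvalue of `−Δ` on the discrete torus at frequency `l`. -/
abbrev latticeEigenvalue (L N : ℕ) (l : Fin 4 → ℤ) : ℝ := lam fun j => (l j : ℝ) / (L : ℝ) ^ N

lemma latticeEigenvalue_nonneg (L N : ℕ) (l : Fin 4 → ℤ) : 0 ≤ latticeEigenvalue L N l := by
  unfold latticeEigenvalue lam
  positivity

lemma massiveMatrix_mulVec_mFourier (L N : ℕ) [NeZero L] (m2 : ℝ) (l : Fin 4 → ℤ) :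
    (massiveMatrix L N m2).mulVec (fun x => UnitAddTorus.mFourier l (torusPoint L N x)) =
      ((latticeEigenvalue L N l + m2 : ℝ) : ℂ) •
        fun x => UnitAddTorus.mFourier l (torusPoint L N x) := by
  funext x
  rw [massiveMatrix_mulVec]
  have h (j : Fin 4) := two_sub_phase_sub_inv L N (l j)
  simp only [mFourier_torusPoint_add_unitVec, mFourier_torusPoint_sub_unitVec, Pi.smul_apply,
    smul_eq_mul, latticeEigenvalue, lam]
  push_cast at h ⊢
  rw [add_mul, Finset.mul_sum, Finset.sum_mul]
  congr 1
  refine Finset.sum_congr rfl fun j _ => ?_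
  rw [← h j]
  ring

lemma greenMatrix_mulVec_mFourier (L N : ℕ) [NeZero L] {m2 : ℝ} (hm : 0 < m2) (l : Fin 4 → ℤ) :
    (greenMatrix L N m2).mulVec (fun x => UnitAddTorus.mFourier l (torusPoint L N x)) =
      (((latticeEigenvalue L N l + m2)⁻¹ : ℝ) : ℂ) •
        fun x => UnitAddTorus.mFourier l (torusPoint L N x) := by
  have h := congrArg (greenMatrix L N m2).mulVec (massiveMatrix_mulVec_mFourier L N m2 l)
  rw [Matrix.mulVec_mulVec, greenMatrix_mul_massiveMatrix L N hm, Matrix.one_mulVec,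
    Matrix.mulVec_smul] at h
  have hne : ((latticeEigenvalue L N l + m2 : ℝ) : ℂ) ≠ 0 :=
    Complex.ofReal_ne_zero.mpr (by linarith [latticeEigenvalue_nonneg L N l])
  rw [Complex.ofReal_inv, eq_inv_smul_iff₀ hne]
  exact h.symm

lemma card_torus (L N : ℕ) [NeZero L] : Fintype.card (Torus L N) = L ^ (4 * N) := by
  simp [ZMod.card, ← pow_mul, mul_comm]

/-- The average over lattice points of a continuous function on the torus. -/
def latticeMean (L N : ℕ) [NeZero L] (f : UnitAddTorus (Fin 4) → ℂ) : ℂ :=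
  ((L : ℂ) ^ (4 * N))⁻¹ * ∑ x : Torus L N, f (torusPoint L N x)

lemma latticeMean_one (L N : ℕ) [NeZero L] : latticeMean L N (fun _ => 1) = 1 := by
  have hL : (L : ℂ) ^ (4 * N) ≠ 0 := pow_ne_zero _ (Nat.cast_ne_zero.mpr (NeZero.ne L))
  simp only [latticeMean, Finset.sum_const, Finset.card_univ, card_torus]
  simp [hL]

lemma latticeMean_mFourier_eq_zero (L N : ℕ) [NeZero L] {l : Fin 4 → ℤ} {j : Fin 4}
    (hj : l j ≠ 0) (hjL : |l j| < (L : ℤ) ^ N) :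
    latticeMean L N (UnitAddTorus.mFourier l) = 0 := by
  have h : ∑ x : Torus L N, UnitAddTorus.mFourier l (torusPoint L N x) =
      phase L N (l j) * ∑ x : Torus L N, UnitAddTorus.mFourier l (torusPoint L N x) := by
    rw [Finset.mul_sum, ← Equiv.sum_comp (Equiv.addRight (unitVec L N j))]
    exact Finset.sum_congr rfl fun x _ => mFourier_torusPoint_add_unitVec L N l x j
  have h0 : ∑ x : Torus L N, UnitAddTorus.mFourier l (torusPoint L N x) = 0 := by
    by_contra hne
    exact phase_ne_one L N hj hjL (mul_right_cancel₀ hne (by rw [one_mul]; exact h.symm))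
  rw [latticeMean, h0, mul_zero]

lemma tendsto_latticeMean_mFourier (L : ℕ) [NeZero L] (hL : 2 ≤ L) (l : Fin 4 → ℤ) :
    Tendsto (fun N => latticeMean L N (UnitAddTorus.mFourier l)) atTop
      (𝓝 (if l = 0 then 1 else 0)) := by
  split_ifs with hl
  · subst hl
    refine tendsto_const_nhds.congr fun N => ?_
    rw [UnitAddTorus.mFourier_zero]
    exact (latticeMean_one L N).symm
  · obtain ⟨j, hj⟩ := Function.ne_iff.mp hl
    refine tendsto_const_nhds.congr' ?_
    have hpow : Tendsto (fun N => (L : ℤ) ^ N) atTop atTop :=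
      tendsto_pow_atTop_atTop_of_one_lt (by exact_mod_cast hL)
    filter_upwards [hpow.eventually_gt_atTop |l j|] with N hN
    exact (latticeMean_mFourier_eq_zero L N hj hN).symm

/-- The rescaled Green bilinear form `m² L^{−4N} ∑ f(x) C_{xy} g(y)`. -/
def greenForm (L N : ℕ) [NeZero L] (m2 : ℝ) :
    C(UnitAddTorus (Fin 4), ℂ) →ₗ[ℂ] C(UnitAddTorus (Fin 4), ℂ) →ₗ[ℂ] ℂ :=
  LinearMap.mk₂ ℂ
    (fun f g => m2 * ((L : ℂ) ^ (4 * N))⁻¹ * ∑ x : Torus L N,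
      f (torusPoint L N x) * (greenMatrix L N m2).mulVec (fun y => g (torusPoint L N y)) x)
    (fun f f' g => by simp only [ContinuousMap.add_apply, add_mul, Finset.sum_add_distrib, mul_add])
    (fun c f g => by
      simp only [ContinuousMap.smul_apply, smul_eq_mul, mul_assoc, ← Finset.mul_sum]
      ring)
    (fun f g g' => by
      have : (fun y => (g + g') (torusPoint L N y)) =
        (fun y => g (torusPoint L N y)) + fun y => g' (torusPoint L N y) := rfl
      simp only [this, Matrix.mulVec_add, Pi.add_apply, mul_add, Finset.sum_add_distrib])
    (fun c f g => by
      have : (fun y => (c • g) (torusPoint L N y)) = c • fun y => g (torusPoint L N y) := rfl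
      simp only [this, Matrix.mulVec_smul, Pi.smul_apply, smul_eq_mul, mul_left_comm _ c,
        ← Finset.mul_sum])

lemma greenForm_apply (L N : ℕ) [NeZero L] (m2 : ℝ) (f g : C(UnitAddTorus (Fin 4), ℂ)) :
    greenForm L N m2 f g = m2 * ((L : ℂ) ^ (4 * N))⁻¹ * ∑ x : Torus L N,
      f (torusPoint L N x) * (greenMatrix L N m2).mulVec (fun y => g (torusPoint L N y)) x := rfl

lemma norm_greenForm_le (L N : ℕ) [NeZero L] {m2 : ℝ} (hm : 0 < m2)
    (f g : C(UnitAddTorus (Fin 4), ℂ)) : ‖greenForm L N m2 f g‖ ≤ ‖f‖ * ‖g‖ := by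
  have hL : (0 : ℝ) < (L : ℝ) ^ (4 * N) :=
    pow_pos (Nat.cast_pos.mpr (NeZero.pos L)) _
  have hterm (x : Torus L N) : m2 * ‖f (torusPoint L N x) *
      (greenMatrix L N m2).mulVec (fun y => g (torusPoint L N y)) x‖ ≤ ‖f‖ * ‖g‖ := by
    rw [norm_mul, mul_left_comm]
    exact mul_le_mul (f.norm_coe_le_norm _)
      (norm_greenMatrix_mulVec_le L N hm _ (fun y => g.norm_coe_le_norm _) x)
      (by positivity) (norm_nonneg _)
  calc ‖greenForm L N m2 f g‖
      ≤ m2 * ((L : ℝ) ^ (4 * N))⁻¹ * ∑ x : Torus L N, ‖f (torusPoint L N x) *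
        (greenMatrix L N m2).mulVec (fun y => g (torusPoint L N y)) x‖ := by
        rw [greenForm_apply, norm_mul, norm_mul, Complex.norm_real, Real.norm_of_nonneg hm.le,
          norm_inv, norm_pow, Complex.norm_natCast]
        gcongr
        exact norm_sum_le _ _
    _ = ((L : ℝ) ^ (4 * N))⁻¹ * ∑ x : Torus L N, m2 * ‖f (torusPoint L N x) *
        (greenMatrix L N m2).mulVec (fun y => g (torusPoint L N y)) x‖ := by
        rw [← Finset.mul_sum]
        ring
    _ ≤ ((L : ℝ) ^ (4 * N))⁻¹ * ∑ _x : Torus L N, ‖f‖ * ‖g‖ := by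
        exact mul_le_mul_of_nonneg_left (Finset.sum_le_sum fun x _ => hterm x) (by positivity)
    _ = ‖f‖ * ‖g‖ := by
        rw [Finset.sum_const, Finset.card_univ, card_torus, nsmul_eq_mul]
        push_cast
        rw [inv_mul_cancel_left₀ hL.ne']

lemma greenForm_mFourier (L N : ℕ) [NeZero L] {m2 : ℝ} (hm : 0 < m2) (k l : Fin 4 → ℤ) :
    greenForm L N m2 (UnitAddTorus.mFourier k) (UnitAddTorus.mFourier l) =
      ((m2 / (latticeEigenvalue L N l + m2) : ℝ) : ℂ) *
        latticeMean L N (UnitAddTorus.mFourier (k + l)) := by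
  rw [greenForm_apply, greenMatrix_mulVec_mFourier L N hm, latticeMean]
  simp only [Pi.smul_apply, smul_eq_mul, UnitAddTorus.mFourier_add,
    mul_left_comm _ (((latticeEigenvalue L N l + m2)⁻¹ : ℝ) : ℂ), ← Finset.mul_sum]
  push_cast
  ring

section TorusIntegrals

attribute [local instance] instMeasureSpaceUnitAddCircle

lemma setIntegral_Ioc_eq_cube {E : Type*} [NormedAddCommGroup E] [NormedSpace ℝ E]
    (g : (Fin 4 → ℝ) → E) :
    ∫ x in {x : Fin 4 → ℝ | ∀ i, x i ∈ Set.Ioc ((0 : Fin 4 → ℝ) i) ((0 : Fin 4 → ℝ) i + 1)}, g x =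
      ∫ x in cube, g x := by
  refine setIntegral_congr_set ?_
  have h := Measure.univ_pi_Ioc_ae_eq_Icc (μ := fun _ : Fin 4 => (volume : Measure ℝ))
    (f := fun _ => 0) (g := fun _ => 1)
  rw [← Set.pi_univ_Icc] at h
  have hset : {x : Fin 4 → ℝ | ∀ i, x i ∈ Set.Ioc ((0 : Fin 4 → ℝ) i) ((0 : Fin 4 → ℝ) i + 1)} =
      Set.univ.pi fun _ => Set.Ioc 0 1 := by
    ext x
    simp [Set.mem_pi]
  rw [hset]
  exact h

lemma mFourierCoeff_eq_setIntegral_cube (f : UnitAddTorus (Fin 4) → ℂ) (l : Fin 4 → ℤ) :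
    UnitAddTorus.mFourierCoeff f l =
      ∫ x in cube, UnitAddTorus.mFourier (-l) (fun i => (x i : UnitAddCircle)) *
        f (fun i => (x i : UnitAddCircle)) := by
  rw [UnitAddTorus.mFourierCoeff_eq_integral f l 0, setIntegral_Ioc_eq_cube]
  rfl

/-- Parseval's identity for continuous functions on the torus. -/
lemma hasSum_sq_mFourierCoeff_cube (f : C(UnitAddTorus (Fin 4), ℂ)) :
    HasSum (fun l => ‖UnitAddTorus.mFourierCoeff f l‖ ^ 2)
      (∫ x in cube, ‖f (fun i => (x i : UnitAddCircle))‖ ^ 2) := by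
  have : IsProbabilityMeasure (volume : Measure UnitAddCircle) :=
    inferInstanceAs (IsProbabilityMeasure AddCircle.haarAddCircle)
  have h := UnitAddTorus.hasSum_sq_mFourierCoeff (f.toLp 2 volume ℂ)
  simp only [UnitAddTorus.mFourierCoeff_toLp] at h
  rw [← setIntegral_Ioc_eq_cube,
    ← UnitAddTorus.integral_preimage (fun t => ‖f t‖ ^ 2) (0 : Fin 4 → ℝ)]
  convert h using 1
  refine integral_congr_ae ?_
  filter_upwards [ContinuousMap.coeFn_toLp (p := 2) (𝕜 := ℂ) volume f] with t ht
  rw [ht]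

end TorusIntegrals

lemma isCompact_cube : IsCompact cube := isCompact_univ_pi fun _ => isCompact_Icc

lemma volume_real_cube : (volume : Measure (Fin 4 → ℝ)).real cube = 1 := by
  rw [cube, Set.pi_univ_Icc, Measure.real, Real.volume_Icc_pi_toReal (fun _ => zero_le_one)]
  simp

lemma continuous_toTorus :
    Continuous fun (x : Fin 4 → ℝ) (i : Fin 4) => (x i : UnitAddCircle) :=
  continuous_pi fun i => (AddCircle.continuous_mk' 1).comp (continuous_apply i)

lemma integrableOn_cube {E : Type*} [NormedAddCommGroup E] {g : (Fin 4 → ℝ) → E}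
    (hg : Continuous g) : IntegrableOn g cube :=
  hg.continuousOn.integrableOn_compact isCompact_cube

/-- The Fourier coefficient as a linear functional on continuous functions. -/
def coeffLM (l : Fin 4 → ℤ) : C(UnitAddTorus (Fin 4), ℂ) →ₗ[ℂ] ℂ where
  toFun f := UnitAddTorus.mFourierCoeff f l
  map_add' f g := by
    simp only [mFourierCoeff_eq_setIntegral_cube, ContinuousMap.add_apply, mul_add]
    have hc := continuous_toTorus
    exact integral_add (integrableOn_cube (by fun_prop)) (integrableOn_cube (by fun_prop))
  map_smul' c f := by
    simp only [mFourierCoeff_eq_setIntegral_cube, ContinuousMap.smul_apply, smul_eq_mul,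
      mul_left_comm _ c, integral_const_mul, RingHom.id_apply]

lemma coeffLM_apply (l : Fin 4 → ℤ) (f : C(UnitAddTorus (Fin 4), ℂ)) :
    coeffLM l f = UnitAddTorus.mFourierCoeff f l := rfl

lemma hasSum_sq_coeffLM (f : C(UnitAddTorus (Fin 4), ℂ)) :
    HasSum (fun l => ‖coeffLM l f‖ ^ 2)
      (∫ x in cube, ‖f (fun i => (x i : UnitAddCircle))‖ ^ 2) :=
  hasSum_sq_mFourierCoeff_cube f

lemma tsum_sq_coeffLM_le (f : C(UnitAddTorus (Fin 4), ℂ)) :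
    ∑' l, ‖coeffLM l f‖ ^ 2 ≤ ‖f‖ ^ 2 := by
  rw [(hasSum_sq_coeffLM f).tsum_eq]
  have hc := continuous_toTorus
  calc ∫ x in cube, ‖f (fun i => (x i : UnitAddCircle))‖ ^ 2
      ≤ ∫ _x in cube, ‖f‖ ^ 2 := by
        refine integral_mono (integrableOn_cube (by fun_prop))
          (integrableOn_cube continuous_const) fun x => ?_
        exact pow_le_pow_left₀ (norm_nonneg _) (f.norm_coe_le_norm _) 2
    _ = ‖f‖ ^ 2 := by rw [setIntegral_const, volume_real_cube, one_smul]

lemma norm_coeffLM_le (l : Fin 4 → ℤ) (f : C(UnitAddTorus (Fin 4), ℂ)) : ‖coeffLM l f‖ ≤ ‖f‖ := by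
  refine le_of_sq_le_sq ?_ (norm_nonneg _)
  exact ((hasSum_sq_coeffLM f).summable.le_tsum l fun _ _ => sq_nonneg _).trans
    (tsum_sq_coeffLM_le f)

lemma coeffLM_mFourier (k l : Fin 4 → ℤ) :
    coeffLM l (UnitAddTorus.mFourier k) = if k = l then 1 else 0 := by
  have h := orthonormal_iff_ite.mp (UnitAddTorus.orthonormal_mFourier (d := Fin 4)) l k
  rw [coeffLM_apply, ← UnitAddTorus.mFourierCoeff_toLp, ← UnitAddTorus.mFourierBasis_repr,
    HilbertBasis.repr_apply_apply, UnitAddTorus.coe_mFourierBasis, h]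
  simp only [eq_comm]

/-- A uniformly bounded sequence of linear functionals that converges on the Fourier monomials
converges on all continuous functions. -/
lemma tendsto_of_tendsto_mFourier (T : ℕ → C(UnitAddTorus (Fin 4), ℂ) →ₗ[ℂ] ℂ)
    (T₀ : C(UnitAddTorus (Fin 4), ℂ) →ₗ[ℂ] ℂ) {C : ℝ} (hT : ∀ N f, ‖T N f‖ ≤ C * ‖f‖)
    (hT₀ : ∀ f, ‖T₀ f‖ ≤ C * ‖f‖)
    (h : ∀ l, Tendsto (fun N => T N (UnitAddTorus.mFourier l)) atTop
      (𝓝 (T₀ (UnitAddTorus.mFourier l)))) (f : C(UnitAddTorus (Fin 4), ℂ)) :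
    Tendsto (fun N => T N f) atTop (𝓝 (T₀ f)) := by
  have hspan : ∀ p ∈ Submodule.span ℂ (Set.range (UnitAddTorus.mFourier (d := Fin 4))),
      Tendsto (fun N => T N p) atTop (𝓝 (T₀ p)) := by
    intro p hp
    induction hp using Submodule.span_induction with
    | mem p hp => obtain ⟨l, rfl⟩ := hp; exact h l
    | zero => simp
    | add p q _ _ hp hq => simpa using hp.add hq
    | smul c p _ hp => simpa using hp.const_mul c
  have hC : 0 ≤ C := by
    have := (norm_nonneg _).trans (hT₀ 1)
    rwa [norm_one, mul_one] at this
  have hf : f ∈ closure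
      (Submodule.span ℂ (Set.range (UnitAddTorus.mFourier (d := Fin 4))) : Set _) := by
    rw [← Submodule.topologicalClosure_coe, UnitAddTorus.span_mFourier_closure_eq_top]
    trivial
  rw [Metric.tendsto_atTop]
  intro ε hε
  obtain ⟨p, hp, hfp⟩ := Metric.mem_closure_iff.mp hf (ε / (3 * (C + 1))) (by positivity)
  obtain ⟨N₀, hN₀⟩ := Metric.tendsto_atTop.mp (hspan p hp) (ε / 3) (by positivity)
  refine ⟨N₀, fun N hN => ?_⟩
  have hsmall : C * ‖f - p‖ ≤ ε / 3 := by
    rw [dist_eq_norm, lt_div_iff₀ (by positivity)] at hfp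
    nlinarith [norm_nonneg (f - p)]
  have h1 := (hT N (f - p)).trans hsmall
  have h2 := (hT₀ (f - p)).trans hsmall
  have h3 := hN₀ N hN
  rw [dist_eq_norm] at h3 ⊢
  have hsplit : T N f - T₀ f = T N (f - p) - T₀ (f - p) + (T N p - T₀ p) := by
    rw [map_sub, map_sub]
    ring
  rw [hsplit]
  calc _ ≤ ‖T N (f - p) - T₀ (f - p)‖ + ‖T N p - T₀ p‖ := norm_add_le _ _
    _ ≤ ‖T N (f - p)‖ + ‖T₀ (f - p)‖ + ‖T N p - T₀ p‖ := by gcongr; exact norm_sub_le _ _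
    _ < ε := by linarith

lemma summable_norm_and_tsum_le {w : (Fin 4 → ℤ) → ℝ} (hw0 : ∀ l, 0 ≤ w l) (hw1 : ∀ l, w l ≤ 1)
    (f g : C(UnitAddTorus (Fin 4), ℂ)) :
    Summable (fun l => ‖(w l : ℂ) * coeffLM (-l) f * coeffLM l g‖) ∧
      ∑' l, ‖(w l : ℂ) * coeffLM (-l) f * coeffLM l g‖ ≤ ‖f‖ * ‖g‖ := by
  have hf : Summable fun l => ‖coeffLM (-l) f‖ ^ 2 :=
    (Equiv.neg (Fin 4 → ℤ)).summable_iff.mpr (hasSum_sq_coeffLM f).summable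
  have hfs : ∑' l, ‖coeffLM (-l) f‖ ^ 2 = ∑' l, ‖coeffLM l f‖ ^ 2 :=
    (Equiv.neg (Fin 4 → ℤ)).tsum_eq fun l => ‖coeffLM l f‖ ^ 2
  have hg : Summable fun l => ‖coeffLM l g‖ ^ 2 := (hasSum_sq_coeffLM g).summable
  obtain ⟨hs, hle⟩ := Real.summable_and_inner_le_Lp_mul_Lq_tsum_of_nonneg
    Real.HolderConjugate.two_two (f := fun l => ‖coeffLM (-l) f‖)
    (g := fun l => ‖coeffLM l g‖) (fun _ => norm_nonneg _) (fun _ => norm_nonneg _)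
    (by simpa using hf) (by simpa using hg)
  have hbd (l : Fin 4 → ℤ) : ‖(w l : ℂ) * coeffLM (-l) f * coeffLM l g‖ ≤
      ‖coeffLM (-l) f‖ * ‖coeffLM l g‖ := by
    rw [norm_mul, norm_mul, Complex.norm_real, Real.norm_of_nonneg (hw0 l), mul_assoc]
    exact mul_le_of_le_one_left (by positivity) (hw1 l)
  have hs' := Summable.of_nonneg_of_le (fun _ => norm_nonneg _) hbd hs
  refine ⟨hs', (hs'.tsum_le_tsum hbd hs).trans (hle.trans ?_)⟩
  simp only [Real.rpow_two, ← Real.sqrt_eq_rpow]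
  rw [hfs]
  exact mul_le_mul (Real.sqrt_le_iff.mpr ⟨norm_nonneg _, tsum_sq_coeffLM_le f⟩)
    (Real.sqrt_le_iff.mpr ⟨norm_nonneg _, tsum_sq_coeffLM_le g⟩) (Real.sqrt_nonneg _)
    (norm_nonneg _)

/-- If the multipliers converge pointwise, the Green bilinear forms converge on continuous
functions. -/
lemma tendsto_greenForm (L : ℕ) [NeZero L] (hL : 2 ≤ L) {m2seq : ℕ → ℝ} (hm : ∀ N, 0 < m2seq N)
    {w : (Fin 4 → ℤ) → ℝ} (hw0 : ∀ l, 0 ≤ w l) (hw1 : ∀ l, w l ≤ 1)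
    (hw : ∀ l, Tendsto (fun N => m2seq N / (latticeEigenvalue L N l + m2seq N)) atTop (𝓝 (w l)))
    (f g : C(UnitAddTorus (Fin 4), ℂ)) :
    Tendsto (fun N => greenForm L N (m2seq N) f g) atTop
      (𝓝 (∑' l, (w l : ℂ) * coeffLM (-l) f * coeffLM l g)) := by
  have hmono (f : C(UnitAddTorus (Fin 4), ℂ)) (l : Fin 4 → ℤ) :
      Tendsto (fun N => greenForm L N (m2seq N) f (UnitAddTorus.mFourier l)) atTop
        (𝓝 (w l * coeffLM (-l) f)) := by
    refine tendsto_of_tendsto_mFourier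
      (fun N => (greenForm L N (m2seq N)).flip (UnitAddTorus.mFourier l))
      ((w l : ℂ) • coeffLM (-l)) (C := 1) (fun N f => ?_) (fun f => ?_) (fun k => ?_) f
    · have := norm_greenForm_le L N (hm N) f (UnitAddTorus.mFourier l)
      rwa [UnitAddTorus.mFourier_norm, mul_comm] at this
    · rw [LinearMap.smul_apply, norm_smul, Complex.norm_real, Real.norm_of_nonneg (hw0 l)]
      exact mul_le_mul (hw1 l) (norm_coeffLM_le _ _) (norm_nonneg _) zero_le_one
    · have := ((Complex.continuous_ofReal.tendsto _).comp (hw l)).mul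
        (tendsto_latticeMean_mFourier L hL (k + l))
      simpa [greenForm_mFourier L _ (hm _), coeffLM_mFourier, eq_neg_iff_add_eq_zero] using this
  have hsum (g : C(UnitAddTorus (Fin 4), ℂ)) :
      Summable fun l => (w l : ℂ) * coeffLM (-l) f * coeffLM l g :=
    (summable_norm_and_tsum_le hw0 hw1 f g).1.of_norm
  let T₀ : C(UnitAddTorus (Fin 4), ℂ) →ₗ[ℂ] ℂ :=
    { toFun := fun g => ∑' l, (w l : ℂ) * coeffLM (-l) f * coeffLM l g
      map_add' := fun g g' => by
        simp only [map_add, mul_add]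
        exact (hsum g).tsum_add (hsum g')
      map_smul' := fun c g => by
        simp only [map_smul, smul_eq_mul, mul_left_comm _ c, RingHom.id_apply]
        exact tsum_mul_left }
  refine tendsto_of_tendsto_mFourier (fun N => greenForm L N (m2seq N) f) T₀ (C := ‖f‖)
    (fun N g => norm_greenForm_le L N (hm N) f g) (fun g => ?_) (fun l => ?_) g
  · exact (norm_tsum_le_tsum_norm (summable_norm_and_tsum_le hw0 hw1 f g).1).trans
      (summable_norm_and_tsum_le hw0 hw1 f g).2
  · have : T₀ (UnitAddTorus.mFourier l) = w l * coeffLM (-l) f := by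
      change ∑' k, (w k : ℂ) * coeffLM (-k) f * coeffLM k (UnitAddTorus.mFourier l) = _
      rw [tsum_eq_single l]
      · simp [coeffLM_mFourier]
      · intro k hk
        simp [coeffLM_mFourier, hk.symm]
    rw [this]
    exact hmono f l

lemma tendsto_scaled_sin (L : ℕ) (hL : 2 ≤ L) (k : ℝ) :
    Tendsto (fun N : ℕ => (L : ℝ) ^ N * Real.sin (Real.pi * (k / (L : ℝ) ^ N))) atTop
      (𝓝 (Real.pi * k)) := by
  have hpos (N : ℕ) : (0 : ℝ) < (L : ℝ) ^ N := by positivity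
  have hpow : Tendsto (fun N : ℕ => (L : ℝ) ^ N) atTop atTop :=
    tendsto_pow_atTop_atTop_of_one_lt (by exact_mod_cast hL)
  have hsinc : Tendsto (fun N : ℕ => Real.pi * k * Real.sinc (Real.pi * (k / (L : ℝ) ^ N))) atTop
      (𝓝 (Real.pi * k)) := by
    have := (Real.continuous_sinc.tendsto _).comp ((hpow.const_div_atTop k).const_mul Real.pi)
    simpa using this.const_mul (Real.pi * k)
  refine hsinc.congr fun N => ?_
  rcases eq_or_ne k 0 with rfl | hk
  · simp
  · have := (hpos N).ne'
    rw [Real.sinc_of_ne_zero (by have := Real.pi_pos.ne'; positivity)]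
    have := Real.pi_pos.ne'
    field_simp

lemma tendsto_scaled_latticeEigenvalue (L : ℕ) (hL : 2 ≤ L) (l : Fin 4 → ℤ) :
    Tendsto (fun N => (L : ℝ) ^ (2 * N) * latticeEigenvalue L N l) atTop
      (𝓝 (4 * Real.pi ^ 2 * ∑ j : Fin 4, (l j : ℝ) ^ 2)) := by
  have h := (tendsto_finsetSum Finset.univ fun j (_ : j ∈ Finset.univ) =>
    (tendsto_scaled_sin L hL (l j)).pow 2).const_mul 4
  convert h using 2 with N
  · simp only [latticeEigenvalue, lam, Finset.mul_sum]
    refine Finset.sum_congr rfl fun j _ => ?_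
    ring
  · simp only [mul_pow, ← Finset.mul_sum, mul_assoc]

lemma multiplier_eq_scaled (L N : ℕ) [NeZero L] (m2 : ℝ) (l : Fin 4 → ℤ) :
    m2 / (latticeEigenvalue L N l + m2) = (L : ℝ) ^ (2 * N) * m2 /
      ((L : ℝ) ^ (2 * N) * latticeEigenvalue L N l + (L : ℝ) ^ (2 * N) * m2) := by
  have hL : (L : ℝ) ^ (2 * N) ≠ 0 := pow_ne_zero _ (Nat.cast_ne_zero.mpr (NeZero.ne L))
  rw [← mul_add, mul_div_mul_left _ _ hL]

lemma tendsto_multiplier_of_tendsto (L : ℕ) [NeZero L] (hL : 2 ≤ L) {m2seq : ℕ → ℝ} {m2 : ℝ}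
    (hm2 : 0 < m2) (hlim : Tendsto (fun N : ℕ => (L : ℝ) ^ (2 * N) * m2seq N) atTop (𝓝 m2))
    (l : Fin 4 → ℤ) :
    Tendsto (fun N => m2seq N / (latticeEigenvalue L N l + m2seq N)) atTop
      (𝓝 (4 * Real.pi ^ 2 * m2⁻¹ * (∑ j : Fin 4, (l j : ℝ) ^ 2) + 1)⁻¹) := by
  simp only [multiplier_eq_scaled]
  have hne : 4 * Real.pi ^ 2 * (∑ j : Fin 4, (l j : ℝ) ^ 2) + m2 ≠ 0 := by positivity
  have h := hlim.div ((tendsto_scaled_latticeEigenvalue L hL l).add hlim) hne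
  have hval : (4 * Real.pi ^ 2 * m2⁻¹ * (∑ j : Fin 4, (l j : ℝ) ^ 2) + 1)⁻¹ =
      m2 / (4 * Real.pi ^ 2 * (∑ j : Fin 4, (l j : ℝ) ^ 2) + m2) := by
    rw [eq_div_iff hne, inv_mul_eq_iff_eq_mul₀ (by positivity)]
    field_simp
  rw [hval]
  exact h

lemma tendsto_multiplier_of_tendsto_atTop (L : ℕ) [NeZero L] (hL : 2 ≤ L) {m2seq : ℕ → ℝ}
    (hm : ∀ N, 0 < m2seq N)
    (hlim : Tendsto (fun N : ℕ => (L : ℝ) ^ (2 * N) * m2seq N) atTop atTop) (l : Fin 4 → ℤ) :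
    Tendsto (fun N => m2seq N / (latticeEigenvalue L N l + m2seq N)) atTop (𝓝 1) := by
  have h := (((tendsto_scaled_latticeEigenvalue L hL l).div_atTop hlim).add_const 1).inv₀
    (by norm_num)
  norm_num at h
  refine h.congr fun N => ?_
  have hpos : 0 < (L : ℝ) ^ (2 * N) * m2seq N :=
    mul_pos (pow_pos (Nat.cast_pos.mpr (NeZero.pos L)) _) (hm N)
  rw [multiplier_eq_scaled, div_add_one hpos.ne', inv_div]

lemma apply_eq_of_toTorus_eq {n : ℕ} {h : (Fin 4 → ℝ) → Fin n → ℝ} (hper : IsPeriodic h)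
    {x y : Fin 4 → ℝ} (hxy : ∀ j, (x j : UnitAddCircle) = (y j : UnitAddCircle)) : h x = h y := by
  have hp (j : Fin 4) : Function.Periodic h (Pi.single j (1 : ℝ)) := fun z => by
    rw [← hper z j]
    congr 1
    funext i
    simp [Pi.single_apply]
  have hk (j : Fin 4) : ∃ k : ℤ, x j = y j + k := by
    have h0 : ((x j - y j : ℝ) : UnitAddCircle) = 0 := by
      rw [AddCircle.coe_sub, hxy j, sub_self]
    obtain ⟨k, hk⟩ := (AddCircle.coe_eq_zero_iff 1).mp h0
    rw [zsmul_one] at hk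
    exact ⟨k, by linarith⟩
  choose k hk using hk
  have hx : x = y + k 0 • Pi.single 0 (1 : ℝ) + k 1 • Pi.single 1 (1 : ℝ) +
      k 2 • Pi.single 2 (1 : ℝ) + k 3 • Pi.single 3 (1 : ℝ) := by
    funext j
    rw [hk j]
    fin_cases j <;> simp
  rw [hx, (hp 3).zsmul (k 3), (hp 2).zsmul (k 2), (hp 1).zsmul (k 1), (hp 0).zsmul (k 0)]

/-- A continuous periodic function descends to the torus. -/
lemma exists_torus_lift {n : ℕ} {h : (Fin 4 → ℝ) → Fin n → ℝ} (hcont : Continuous h)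
    (hper : IsPeriodic h) (i : Fin n) :
    ∃ F : C(UnitAddTorus (Fin 4), ℂ), ∀ x : Fin 4 → ℝ,
      F (fun j => (x j : UnitAddCircle)) = (h x i : ℂ) := by
  have hq : IsOpenQuotientMap
      (Pi.map fun (_ : Fin 4) (t : ℝ) => (t : UnitAddCircle)) :=
    IsOpenQuotientMap.piMap fun _ => QuotientAddGroup.isOpenQuotientMap_mk
  let g : C(Fin 4 → ℝ, ℂ) := ⟨fun x => (h x i : ℂ), by fun_prop⟩
  let π : C(Fin 4 → ℝ, UnitAddTorus (Fin 4)) := ⟨_, hq.continuous⟩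
  have hπ : Topology.IsQuotientMap π := hq.isQuotientMap
  have hfac : Function.FactorsThrough g π := fun x y hxy => by
    change ((h x i : ℝ) : ℂ) = (h y i : ℝ)
    rw [apply_eq_of_toTorus_eq hper fun j => congrFun hxy j]
  refine ⟨hπ.lift g hfac, fun x => ?_⟩
  exact DFunLike.congr_fun (hπ.lift_comp g hfac) x

section Lift

variable {n : ℕ} {h : (Fin 4 → ℝ) → Fin n → ℝ} {F : Fin n → C(UnitAddTorus (Fin 4), ℂ)}

lemma coeffLM_eq_fourierCoeff
    (hF : ∀ i (x : Fin 4 → ℝ), F i (fun j => (x j : UnitAddCircle)) = (h x i : ℂ))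
    (l : Fin 4 → ℤ) (i : Fin n) : coeffLM l (F i) = fourierCoeff h l i := by
  rw [coeffLM_apply, mFourierCoeff_eq_setIntegral_cube, fourierCoeff]
  congr 1
  funext x
  rw [hF, mul_comm]
  congr 1
  simp only [UnitAddTorus.mFourier, ContinuousMap.coe_mk, fourier_coe_apply, ← Complex.exp_sum]
  rw [Finset.mul_sum]
  congr 1
  refine Finset.sum_congr rfl fun j _ => ?_
  simp only [Pi.neg_apply]
  push_cast
  ring

lemma coeffLM_neg
    (hF : ∀ i (x : Fin 4 → ℝ), F i (fun j => (x j : UnitAddCircle)) = (h x i : ℂ))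
    (l : Fin 4 → ℤ) (i : Fin n) : coeffLM (-l) (F i) = starRingEnd ℂ (coeffLM l (F i)) := by
  simp only [coeffLM_apply, mFourierCoeff_eq_setIntegral_cube]
  rw [← integral_conj]
  congr 1
  funext x
  rw [hF, map_mul, Complex.conj_ofReal, UnitAddTorus.mFourier_neg, UnitAddTorus.mFourier_neg]

lemma ofReal_quadForm
    (hF : ∀ i (x : Fin 4 → ℝ), F i (fun j => (x j : UnitAddCircle)) = (h x i : ℂ))
    (L N : ℕ) [NeZero L] (m2 : ℝ) :
    (quadForm L N n m2 h : ℂ) = ∑ i, greenForm L N m2 (F i) (F i) := by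
  have hpt (i : Fin n) (x : Torus L N) : F i (torusPoint L N x) = (h (embed L N x) i : ℂ) := by
    rw [torusPoint_eq_embed, hF]
  simp only [greenForm_apply, hpt, quadForm, ← Finset.mul_sum, Matrix.mulVec, dotProduct,
    greenMatrix, Matrix.map_apply, Complex.ofRealHom_eq_coe]
  push_cast
  congr 1
  refine Eq.trans (Finset.sum_congr rfl fun x _ => ?_) Finset.sum_comm
  refine Eq.trans Finset.sum_comm (Finset.sum_congr rfl fun i _ => ?_)
  simp only [Finset.mul_sum, mul_assoc]

lemma summable_multiplier_mul_sq
    (hF : ∀ i (x : Fin 4 → ℝ), F i (fun j => (x j : UnitAddCircle)) = (h x i : ℂ))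
    {w : (Fin 4 → ℤ) → ℝ} (hw0 : ∀ l, 0 ≤ w l) (hw1 : ∀ l, w l ≤ 1) (i : Fin n) :
    Summable fun l => w l * ‖fourierCoeff h l i‖ ^ 2 := by
  refine Summable.of_nonneg_of_le (fun l => mul_nonneg (hw0 l) (sq_nonneg _))
    (fun l => mul_le_of_le_one_left (sq_nonneg _) (hw1 l)) ?_
  simpa only [coeffLM_eq_fourierCoeff hF] using (hasSum_sq_coeffLM (F i)).summable

lemma tendsto_quadForm
    (hF : ∀ i (x : Fin 4 → ℝ), F i (fun j => (x j : UnitAddCircle)) = (h x i : ℂ))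
    (L : ℕ) [NeZero L] (hL : 2 ≤ L) {m2seq : ℕ → ℝ} (hm : ∀ N, 0 < m2seq N)
    {w : (Fin 4 → ℤ) → ℝ} (hw0 : ∀ l, 0 ≤ w l) (hw1 : ∀ l, w l ≤ 1)
    (hw : ∀ l, Tendsto (fun N => m2seq N / (latticeEigenvalue L N l + m2seq N)) atTop
      (𝓝 (w l))) :
    Tendsto (fun N => quadForm L N n (m2seq N) h) atTop
      (𝓝 (∑ i, ∑' l, w l * ‖fourierCoeff h l i‖ ^ 2)) := by
  have hlim := tendsto_finsetSum Finset.univ fun i (_ : i ∈ Finset.univ) =>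
    tendsto_greenForm L hL hm hw0 hw1 hw (F i) (F i)
  have hterm (l : Fin 4 → ℤ) (i : Fin n) : (w l : ℂ) * coeffLM (-l) (F i) * coeffLM l (F i) =
      ((w l * ‖fourierCoeff h l i‖ ^ 2 : ℝ) : ℂ) := by
    rw [coeffLM_neg hF, mul_assoc, Complex.conj_mul', coeffLM_eq_fourierCoeff hF]
    push_cast
    rfl
  simp only [hterm, ← Complex.ofReal_tsum, ← Complex.ofReal_sum, ← ofReal_quadForm hF] at hlim
  exact (Complex.continuous_re.tendsto _).comp hlim

lemma sum_tsum_sq_fourierCoeff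
    (hF : ∀ i (x : Fin 4 → ℝ), F i (fun j => (x j : UnitAddCircle)) = (h x i : ℂ))
    (hcont : Continuous h) :
    ∑ i, ∑' l, ‖fourierCoeff h l i‖ ^ 2 = pairL2 h := by
  unfold pairL2 normSq
  rw [integral_finsetSum _ fun i _ => integrableOn_cube (by fun_prop)]
  refine Finset.sum_congr rfl fun i _ => ?_
  simp only [← coeffLM_eq_fourierCoeff hF]
  rw [(hasSum_sq_coeffLM (F i)).tsum_eq]
  simp [hF]

end Lift

/-- convergence of the rescaled Green quadratic forms
`m_N² L^{−4N} (h_N, (−Δ_{Λ_N} + m_N²)⁻¹ h_N)`: (a) to the massive GFF variance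
if `L^{2N} m_N² → m² ∈ (0,∞)`; (b) to `(h,h)` if `L^{2N} m_N² → ∞`. -/
theorem green_quadratic_form_limit (L n : ℕ) [NeZero L] [NeZero n]
    (hL : 2 ≤ L) (hn : 1 ≤ n)
    (h : (Fin 4 → ℝ) → Fin n → ℝ) (hsmooth : ContDiff ℝ (⊤ : ℕ∞) h) (hper : IsPeriodic h)
    (m2seq : ℕ → ℝ) (hm : ∀ N : ℕ, 0 < m2seq N) :
    (∀ m2 : ℝ, 0 < m2 →
      Tendsto (fun N : ℕ => (L : ℝ) ^ (2 * N) * m2seq N) atTop (𝓝 m2) →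
      Tendsto (fun N : ℕ => quadForm L N n (m2seq N) h) atTop (𝓝 (gffVar h m2))) ∧
    (Tendsto (fun N : ℕ => (L : ℝ) ^ (2 * N) * m2seq N) atTop atTop →
      Tendsto (fun N : ℕ => quadForm L N n (m2seq N) h) atTop (𝓝 (pairL2 h))) := by
  have hcont := hsmooth.continuous
  choose F hF using exists_torus_lift hcont hper
  refine ⟨fun m2 hm2 hlim => ?_, fun hlim => ?_⟩
  · have hden (l : Fin 4 → ℤ) :
        1 ≤ 4 * Real.pi ^ 2 * m2⁻¹ * (∑ j : Fin 4, (l j : ℝ) ^ 2) + 1 :=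
      le_add_of_nonneg_left (by positivity)
    have hw0 (l : Fin 4 → ℤ) :
        0 ≤ (4 * Real.pi ^ 2 * m2⁻¹ * (∑ j : Fin 4, (l j : ℝ) ^ 2) + 1)⁻¹ := by positivity
    have hw1 (l : Fin 4 → ℤ) := inv_le_one_of_one_le₀ (hden l)
    have hgff : gffVar h m2 = ∑ i, ∑' l : Fin 4 → ℤ,
        (4 * Real.pi ^ 2 * m2⁻¹ * (∑ j : Fin 4, (l j : ℝ) ^ 2) + 1)⁻¹ *
          ‖fourierCoeff h l i‖ ^ 2 := by
      rw [← Summable.tsum_finsetSum fun i _ => summable_multiplier_mul_sq hF hw0 hw1 i]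
      simp only [gffVar, ← Finset.mul_sum, div_eq_inv_mul]
    rw [hgff]
    exact tendsto_quadForm hF L hL hm hw0 hw1 (tendsto_multiplier_of_tendsto L hL hm2 hlim)
  · rw [← sum_tsum_sq_fourierCoeff hF hcont]
    simpa using tendsto_quadForm hF L hL hm (w := fun _ => 1) (fun _ => zero_le_one)
      (fun _ => le_rfl) (tendsto_multiplier_of_tendsto_atTop L hL hm hlim)
end Phi4
end
end

section
/- Fix integers L ≥ 2, n ≥ 1 and s ≥ 0. There exists a constant c = c(s, L) > 0, independent of N, m² and h, such that the following holds. Let m² > 0, N ≥ 1, h ∈ C^{s+4}(𝕋^4, ℝ^n), define h_N : Λ_N → ℝ^n by h_N(x) = h(L^{−N}x), and let C^{(N)} = (−Δ_{Λ_N} + m²)^{−1} act componentwise on ℝ^n-valued functions on Λ_N. Then for every multi-index α ∈ ℕ^4 with |α|_1 ≤ s and every component i ∈ {1,…,n}: L^{N|α|_1} · max_{x ∈ Λ_N} |∇^α (C^{(N)} h_N)^i(x)| ≤ c · m^{−2} · ‖h‖_{C^{s+4}}, where ‖h‖_{C^{s+4}} = max over multi-indices β with |β|_1 ≤ s+4 and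 components i of sup_{x ∈ 𝕋^4} |∂^β h^i(x)|. -/
open MeasureTheory Filter Topology

noncomputable section

namespace Phi4

/-- The directions of a multi-index, listed in the order in which `∇^α` and `∂^α` apply them. -/
def directions (α : Fin 4 → ℕ) : List (Fin 4) :=
  List.replicate (α 3) 3 ++ (List.replicate (α 2) 2 ++
    (List.replicate (α 1) 1 ++ List.replicate (α 0) 0))

theorem length_directions (α : Fin 4 → ℕ) : (directions α).length = ∑ j, α j := by
  simp only [directions, List.length_append, List.length_replicate, Fin.sum_univ_four]
  ring

theorem foldl_replicate_eq_iterate {X ι : Type*} (T : ι → X → X) (j : ι) (a : ℕ) (f : X) :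
    (List.replicate a j).foldl (fun g i => T i g) f = (T j)^[a] f := by
  induction a generalizing f with
  | zero => rfl
  | succ a ih => simp [List.replicate_succ, ih]

theorem foldl_directions {X : Type*} (T : Fin 4 → X → X) (α : Fin 4 → ℕ) (f : X) :
    (directions α).foldl (fun g i => T i g) f =
      (T 0)^[α 0] ((T 1)^[α 1] ((T 2)^[α 2] ((T 3)^[α 3] f))) := by
  simp only [directions, List.foldl_append, foldl_replicate_eq_iterate]

/-- The forward difference of step `ε` in direction `j` on `ℝ^4`. -/
def stepDiff (ε : ℝ) (j : Fin 4) (f : (Fin 4 → ℝ) → ℝ) : (Fin 4 → ℝ) → ℝ :=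
  fun x => f (x + Pi.single j ε) - f x

theorem contDiff_pderiv1 {k : ℕ} {f : (Fin 4 → ℝ) → ℝ} (hf : ContDiff ℝ (k + 1 : ℕ) f)
    (j : Fin 4) : ContDiff ℝ k (pderiv1 j f) :=
  (hf.fderiv_right (m := k) (by norm_cast)).clm_apply contDiff_const

theorem contDiff_stepDiff {k : WithTop ℕ∞} {f : (Fin 4 → ℝ) → ℝ} (hf : ContDiff ℝ k f) (ε : ℝ)
    (j : Fin 4) : ContDiff ℝ k (stepDiff ε j f) :=
  (hf.comp (contDiff_id.add contDiff_const)).sub hf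

theorem stepDiff_comm (ε : ℝ) (i j : Fin 4) (f : (Fin 4 → ℝ) → ℝ) :
    stepDiff ε i (stepDiff ε j f) = stepDiff ε j (stepDiff ε i f) := by
  funext x
  simp only [stepDiff, add_right_comm x (Pi.single i ε)]
  ring

theorem pderiv1_stepDiff (ε : ℝ) (i j : Fin 4) {f : (Fin 4 → ℝ) → ℝ} (hf : Differentiable ℝ f) :
    pderiv1 i (stepDiff ε j f) = stepDiff ε j (pderiv1 i f) := by
  funext x
  have h1 : DifferentiableAt ℝ (fun y => f (y + Pi.single j ε)) x :=
    (hf.comp (differentiable_id.add_const _)) x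
  change fderiv ℝ (fun y => f (y + Pi.single j ε) - f y) x _ = _
  rw [fderiv_fun_sub h1 (hf x), fderiv_comp_add_right]
  rfl

theorem foldl_stepDiff_comm (ε : ℝ) (j : Fin 4) (l : List (Fin 4)) (f : (Fin 4 → ℝ) → ℝ) :
    l.foldl (fun g i => stepDiff ε i g) (stepDiff ε j f) =
      stepDiff ε j (l.foldl (fun g i => stepDiff ε i g) f) := by
  induction l generalizing f with
  | nil => rfl
  | cons i l ih => simp only [List.foldl_cons, stepDiff_comm ε i j, ih]

theorem contDiff_foldl_stepDiff {k : WithTop ℕ∞} (ε : ℝ) (l : List (Fin 4))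
    {f : (Fin 4 → ℝ) → ℝ} (hf : ContDiff ℝ k f) :
    ContDiff ℝ k (l.foldl (fun g i => stepDiff ε i g) f) := by
  induction l generalizing f with
  | nil => exact hf
  | cons i l ih => exact ih (contDiff_stepDiff hf ε i)

theorem pderiv1_foldl_stepDiff (ε : ℝ) (j : Fin 4) (l : List (Fin 4)) {f : (Fin 4 → ℝ) → ℝ}
    (hf : ContDiff ℝ 1 f) :
    pderiv1 j (l.foldl (fun g i => stepDiff ε i g) f) =
      l.foldl (fun g i => stepDiff ε i g) (pderiv1 j f) := by
  induction l generalizing f with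
  | nil => rfl
  | cons i l ih =>
    simp only [List.foldl_cons]
    rw [ih (contDiff_stepDiff hf ε i), pderiv1_stepDiff ε j i (hf.differentiable one_ne_zero)]

theorem abs_stepDiff_le {ε B : ℝ} (hε : 0 ≤ ε) (j : Fin 4) {f : (Fin 4 → ℝ) → ℝ}
    (hf : Differentiable ℝ f) (hB : ∀ x, |pderiv1 j f x| ≤ B) (x : Fin 4 → ℝ) :
    |stepDiff ε j f x| ≤ ε * B := by
  have hline : ∀ t : ℝ, HasDerivAt (fun t : ℝ => f (x + t • Pi.single j (1 : ℝ)))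
      (pderiv1 j f (x + t • Pi.single j (1 : ℝ))) t := fun t =>
    (hf _).hasFDerivAt.comp_hasDerivAt t
      (by simpa using ((hasDerivAt_id t).smul_const (Pi.single j (1 : ℝ))).const_add x)
  have key := Convex.norm_image_sub_le_of_norm_hasDerivWithin_le (s := Set.univ) (x := 0) (y := ε)
    (fun t _ => (hline t).hasDerivWithinAt) (fun t _ => hB _) convex_univ trivial trivial
  have hs : ε • (Pi.single j (1 : ℝ) : Fin 4 → ℝ) = Pi.single j ε := by
    rw [← Pi.single_smul', smul_eq_mul, mul_one]
  simp only [hs, zero_smul, add_zero, sub_zero, Real.norm_eq_abs, abs_of_nonneg hε] at key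
  rw [mul_comm]
  exact key

theorem abs_foldl_stepDiff_le {ε B : ℝ} (hε : 0 ≤ ε) (l : List (Fin 4)) {f : (Fin 4 → ℝ) → ℝ}
    (hf : ContDiff ℝ l.length f) (hB : ∀ x, |l.foldl (fun g i => pderiv1 i g) f x| ≤ B)
    (x : Fin 4 → ℝ) :
    |l.foldl (fun g i => stepDiff ε i g) f x| ≤ ε ^ l.length * B := by
  induction l generalizing f x with
  | nil => simpa using hB x
  | cons j l ih =>
    have hf1 : ContDiff ℝ 1 f := hf.of_le (by simp)
    rw [List.foldl_cons, foldl_stepDiff_comm, List.length_cons, pow_succ', mul_assoc]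
    refine abs_stepDiff_le hε j
      ((contDiff_foldl_stepDiff ε l hf1).differentiable one_ne_zero) (fun y => ?_) x
    rw [pderiv1_foldl_stepDiff ε j l hf1]
    exact ih (contDiff_pderiv1 hf j) hB y

section Lattice

variable {L N : ℕ} [NeZero L]

theorem apply_embed_add_unitVec (hN : 1 < L ^ N) {f : (Fin 4 → ℝ) → ℝ}
    (hf : ∀ x j, f (x + Pi.single j 1) = f x) (x : Torus L N) (j : Fin 4) :
    f (embed L N (x + unitVec L N j)) = f (embed L N x + Pi.single j ((L : ℝ) ^ N)⁻¹) := by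
  have hpos : (L : ℝ) ^ N ≠ 0 := by exact_mod_cast (by omega : L ^ N ≠ 0)
  have : Fact (1 < L ^ N) := ⟨hN⟩
  have hlt := ZMod.val_lt (x j)
  rcases (Nat.succ_le_of_lt hlt).lt_or_eq with h | h
  · congr 1
    funext i
    rcases eq_or_ne i j with rfl | hij
    · have hv : (x i + 1).val = (x i).val + 1 := by
        rw [ZMod.val_add, ZMod.val_one, Nat.mod_eq_of_lt h]
      simp [embed, unitVec, hv, add_div]
    · simp [embed, unitVec, hij]
  · rw [← hf (embed L N (x + unitVec L N j)) j]
    congr 1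
    funext i
    rcases eq_or_ne i j with rfl | hij
    · have hv : (x i + 1).val = 0 := by
        rw [ZMod.val_add, ZMod.val_one, ← Nat.succ_eq_add_one, h, Nat.mod_self]
      have hc : ((x i).val : ℝ) + 1 = (L : ℝ) ^ N := by exact_mod_cast h
      simp only [embed, unitVec, Pi.add_apply, if_true, hv, Pi.single_eq_same]
      field_simp
      linarith [Nat.cast_zero (R := ℝ)]
    · simp [embed, unitVec, hij]

theorem foldl_fwdDiff_embed (hN : 1 < L ^ N) (l : List (Fin 4)) {f : (Fin 4 → ℝ) → ℝ}
    (hf : ∀ x j, f (x + Pi.single j 1) = f x) :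
    l.foldl (fun g i => fwdDiff L N i g) (fun x => f (embed L N x)) =
      fun x => l.foldl (fun g i => stepDiff ((L : ℝ) ^ N)⁻¹ i g) f (embed L N x) := by
  induction l generalizing f with
  | nil => rfl
  | cons j l ih =>
    have hstep : fwdDiff L N j (fun x => f (embed L N x)) =
        fun x => stepDiff ((L : ℝ) ^ N)⁻¹ j f (embed L N x) := by
      funext x
      simp only [fwdDiff, stepDiff, apply_embed_add_unitVec hN hf]
    simp only [List.foldl_cons]
    rw [hstep]
    refine ih fun x i => ?_
    simp only [stepDiff]
    rw [add_right_comm, hf, hf]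

theorem massiveLap_mulVec (m2 : ℝ) (v : Torus L N → ℝ) (x : Torus L N) :
    (negLapMatrix L N + m2 • (1 : Matrix (Torus L N) (Torus L N) ℝ)).mulVec v x =
      (∑ j, ((v x - v (x + unitVec L N j)) + (v x - v (x - unitVec L N j)))) + m2 * v x := by
  rw [Matrix.add_mulVec, Matrix.smul_mulVec, Matrix.one_mulVec]
  simp only [Pi.add_apply, Pi.smul_apply, smul_eq_mul, add_left_inj]
  simp only [Matrix.mulVec, dotProduct, negLapMatrix, Matrix.of_apply, Finset.sum_mul]
  rw [Finset.sum_comm]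
  refine Finset.sum_congr rfl fun j _ => ?_
  simp [add_mul, sub_mul, Finset.sum_add_distrib, Finset.sum_sub_distrib]

theorem massiveLap_mulVec_fwdDiff (m2 : ℝ) (j : Fin 4) (v : Torus L N → ℝ) :
    (negLapMatrix L N + m2 • (1 : Matrix (Torus L N) (Torus L N) ℝ)).mulVec (fwdDiff L N j v) =
      fwdDiff L N j
        ((negLapMatrix L N + m2 • (1 : Matrix (Torus L N) (Torus L N) ℝ)).mulVec v) := by
  funext x
  simp only [massiveLap_mulVec, fwdDiff, add_right_comm x (unitVec L N j),
    add_sub_right_comm x (unitVec L N j), Fin.sum_univ_four]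
  ring

theorem massiveLap_mulVec_foldl_fwdDiff (m2 : ℝ) (l : List (Fin 4)) (v : Torus L N → ℝ) :
    (negLapMatrix L N + m2 • (1 : Matrix (Torus L N) (Torus L N) ℝ)).mulVec
        (l.foldl (fun g i => fwdDiff L N i g) v) =
      l.foldl (fun g i => fwdDiff L N i g)
        ((negLapMatrix L N + m2 • (1 : Matrix (Torus L N) (Torus L N) ℝ)).mulVec v) := by
  induction l generalizing v with
  | nil => rfl
  | cons j l ih => simp only [List.foldl_cons, ih, massiveLap_mulVec_fwdDiff]

/-- One-sided discrete maximum principle for `-Δ + m²`. -/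
theorem massiveLap_max_principle {m2 G : ℝ} (hm : 0 < m2) {v : Torus L N → ℝ}
    (hG : ∀ x, (negLapMatrix L N + m2 • (1 : Matrix (Torus L N) (Torus L N) ℝ)).mulVec v x ≤ G)
    (x : Torus L N) : v x ≤ m2⁻¹ * G := by
  obtain ⟨x₀, hx₀⟩ := Finite.exists_max v
  have hsum : 0 ≤ ∑ j, ((v x₀ - v (x₀ + unitVec L N j)) + (v x₀ - v (x₀ - unitVec L N j))) :=
    Finset.sum_nonneg fun j _ =>
      add_nonneg (sub_nonneg.2 (hx₀ _)) (sub_nonneg.2 (hx₀ _))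
  have h := hG x₀
  rw [massiveLap_mulVec] at h
  rw [le_inv_mul_iff₀ hm]
  nlinarith [hx₀ x]

theorem abs_le_of_abs_massiveLap_le {m2 G : ℝ} (hm : 0 < m2) {v : Torus L N → ℝ}
    (hG : ∀ x,
      |(negLapMatrix L N + m2 • (1 : Matrix (Torus L N) (Torus L N) ℝ)).mulVec v x| ≤ G)
    (x : Torus L N) : |v x| ≤ m2⁻¹ * G := by
  rw [abs_le', ← Pi.neg_apply]
  refine ⟨massiveLap_max_principle hm (fun y => (le_abs_self _).trans (hG y)) x,
    massiveLap_max_principle hm (fun y => ?_) x⟩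
  rw [Matrix.mulVec_neg]
  exact (neg_le_abs _).trans (hG y)

theorem isUnit_massiveLap {m2 : ℝ} (hm : 0 < m2) :
    IsUnit (negLapMatrix L N + m2 • (1 : Matrix (Torus L N) (Torus L N) ℝ)) := by
  rw [← Matrix.mulVec_injective_iff_isUnit]
  intro v w hvw
  funext x
  have h := abs_le_of_abs_massiveLap_le (G := 0) (v := v - w) hm
    (fun y => by rw [Matrix.mulVec_sub, show Matrix.mulVec _ v = _ from hvw]; simp) x
  rw [mul_zero, abs_nonpos_iff] at h
  exact sub_eq_zero.1 h

end Lattice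

/-- lattice Sobolev-type estimate for the smoothed test function
`C⁽ᴺ⁾ h_N`: discrete derivatives of order `≤ s` are bounded by
`c · m⁻² · ‖h‖_{C^{s+4}}`, uniformly in `N`, `m²` and `h`. -/
theorem green_smoothing_estimate (L n s : ℕ) [NeZero L] [NeZero n]
    (hL : 2 ≤ L) (hn : 1 ≤ n) :
    ∃ c : ℝ, 0 < c ∧
      ∀ m2 : ℝ, 0 < m2 → ∀ N : ℕ, 1 ≤ N →
        ∀ h : (Fin 4 → ℝ) → Fin n → ℝ,
          ContDiff ℝ ((s : ℕ∞) + 4) h → IsPeriodic h →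
          ∀ B : ℝ,
            (∀ β : Fin 4 → ℕ, (∑ j : Fin 4, β j) ≤ s + 4 →
              ∀ (i : Fin n) (x : Fin 4 → ℝ),
                |pderivMulti β (fun y => h y i) x| ≤ B) →
            ∀ α : Fin 4 → ℕ, (∑ j : Fin 4, α j) ≤ s →
              ∀ (i : Fin n) (x : Torus L N),
                (L : ℝ) ^ (N * ∑ j : Fin 4, α j) *
                    |fwdDiffMulti L N α
                      (fun y => ∑ z : Torus L N,
                        ((negLapMatrix L N +
                            m2 • (1 : Matrix (Torus L N) (Torus L N) ℝ))⁻¹ y z) *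
                          h (embed L N z) i) x| ≤
                  c * m2⁻¹ * B := by
  refine ⟨1, one_pos, fun m2 hm N hN h hh hper B hB α hα i x => ?_⟩
  have hLN : 1 < L ^ N := Nat.one_lt_pow (by omega) (by omega)
  have hLpos : (0 : ℝ) < (L : ℝ) ^ N := by exact_mod_cast (by omega : 0 < L ^ N)
  set A := negLapMatrix L N + m2 • (1 : Matrix (Torus L N) (Torus L N) ℝ) with hA
  set f : (Fin 4 → ℝ) → ℝ := fun y => h y i with hf
  have hfper : ∀ y j, f (y + Pi.single j 1) = f y := fun y j => by
    rw [hf]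
    simp only
    rw [← hper y j]
    congr 2
    funext k
    simp [Pi.single_apply]
  have hfC : ContDiff ℝ (directions α).length f := by
    refine (contDiff_pi.1 hh i).of_le ?_
    rw [length_directions]
    have hle : ((∑ j, α j : ℕ) : WithTop ℕ∞) ≤ ((s + 4 : ℕ) : WithTop ℕ∞) := by
      exact_mod_cast hα.trans (Nat.le_add_right s 4)
    exact hle.trans_eq (by push_cast; rfl)
  have hpd : ∀ y, |(directions α).foldl (fun g i => pderiv1 i g) f y| ≤ B := fun y => by
    rw [foldl_directions]
    exact hB α (hα.trans (Nat.le_add_right s 4)) i y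
  have hdet : IsUnit A.det := (Matrix.isUnit_iff_isUnit_det A).1 (isUnit_massiveLap hm)
  have hsolve : A.mulVec (A⁻¹.mulVec fun z => f (embed L N z)) = fun z => f (embed L N z) := by
    rw [Matrix.mulVec_mulVec, Matrix.mul_nonsing_inv A hdet, Matrix.one_mulVec]
  have key : |(directions α).foldl (fun g i => fwdDiff L N i g)
      (A⁻¹.mulVec fun z => f (embed L N z)) x| ≤
        m2⁻¹ * (((L : ℝ) ^ N)⁻¹ ^ (directions α).length * B) := by
    refine abs_le_of_abs_massiveLap_le hm (fun y => ?_) x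
    rw [massiveLap_mulVec_foldl_fwdDiff, ← hA, hsolve, foldl_fwdDiff_embed hLN _ hfper]
    exact abs_foldl_stepDiff_le (inv_nonneg.2 hLpos.le) _ hfC hpd _
  rw [foldl_directions, length_directions] at key
  rw [pow_mul]
  calc _ ≤ ((L : ℝ) ^ N) ^ (∑ j, α j) * (m2⁻¹ * (((L : ℝ) ^ N)⁻¹ ^ (∑ j, α j) * B)) :=
        mul_le_mul_of_nonneg_left key (by positivity)
    _ = 1 * m2⁻¹ * B := by
        rw [inv_pow]
        field_simp
end Phi4
end
end

section
/- Let λ(k) = 4Σ_{j=1}^{4} sin²(πk_j) for k ∈ [0,1]^4, and for m² ≥ 0 let C_{m²}(0) = ∫_{[0,1]^4} (λ(k) + m²)^{−1} dk. Then: (a) the integral defining C_0(0) converges and 0 < C_0(0) < ∞; (b) there exists c > 0 such that for all m² ∈ (0, 1/2]: 0 ≤ C_0(0) − C_{m²}(0) ≤ c·m²·(1 + log(1/m²)). -/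
open MeasureTheory Filter Topology

noncomputable section

namespace Phi4

lemma measurable_lam : Measurable lam := by
  unfold lam; fun_prop

lemma lam_le (k : Fin 4 → ℝ) : lam k ≤ 16 := by
  have h : ∑ j : Fin 4, Real.sin (Real.pi * k j) ^ 2 ≤ ∑ _j : Fin 4, (1 : ℝ) :=
    Finset.sum_le_sum fun j _ => Real.sin_sq_le_one _
  simp only [Finset.sum_const, Finset.card_univ, Fintype.card_fin] at h
  unfold lam
  norm_num at h
  linarith

lemma measurableSet_cube : MeasurableSet cube :=
  MeasurableSet.univ_pi fun _ => measurableSet_Icc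

lemma volume_cube : volume cube = 1 := by
  rw [cube, volume_pi_pi]
  simp

/-- Jordan's inequality: `|sin (π x)|` dominates twice the distance from `x` to `{0, 1}`. -/
lemma two_mul_min_le_sin {x : ℝ} (h0 : 0 ≤ x) (h1 : x ≤ 1) :
    2 * min x (1 - x) ≤ Real.sin (Real.pi * x) := by
  have key : ∀ y : ℝ, 0 ≤ y → y ≤ 1 / 2 → 2 * y ≤ Real.sin (Real.pi * y) := fun y hy hy' => by
    have h := Real.mul_le_sin (x := Real.pi * y) (by positivity) (by nlinarith [Real.pi_pos])
    rwa [← mul_assoc, div_mul_cancel₀ _ Real.pi_ne_zero] at h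
  rcases le_total x (1 / 2) with h | h
  · rw [min_eq_left (by linarith)]
    exact key x h0 h
  · rw [min_eq_right (by linarith), ← Real.sin_pi_sub]
    convert key (1 - x) (by linarith) (by linarith) using 2
    ring

lemma volume_lam_lt_le {u : ℝ} (hu : 0 ≤ u) :
    volume.restrict cube {k | lam k < u} ≤ ENNReal.ofReal (u ^ 2 / 16) := by
  have hsub : {k | lam k < u} ∩ cube ⊆ Set.univ.pi fun _ : Fin 4 =>
      Set.Icc 0 (√u / 4) ∪ Set.Icc (1 - √u / 4) 1 := by
    rintro k ⟨hk, hc⟩ j -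
    obtain ⟨h0, h1⟩ := hc j trivial
    have hj : Real.sin (Real.pi * k j) ^ 2 ≤ ∑ i : Fin 4, Real.sin (Real.pi * k i) ^ 2 :=
      Finset.single_le_sum (f := fun i => Real.sin (Real.pi * k i) ^ 2)
        (fun i _ => sq_nonneg _) (Finset.mem_univ j)
    have hk' : 4 * ∑ i : Fin 4, Real.sin (Real.pi * k i) ^ 2 < u := hk
    have hmin := two_mul_min_le_sin h0 h1
    have hsqrt : 4 * min (k j) (1 - k j) ≤ √u := by
      apply Real.le_sqrt_of_sq_le
      have : 0 ≤ min (k j) (1 - k j) := le_min h0 (by linarith)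
      nlinarith
    rcases min_choice (k j) (1 - k j) with h | h <;> rw [h] at hsqrt
    · exact Or.inl ⟨h0, by linarith⟩
    · exact Or.inr ⟨by linarith, h1⟩
  have hside : volume (Set.Icc 0 (√u / 4) ∪ Set.Icc (1 - √u / 4) 1) ≤
      ENNReal.ofReal (√u / 2) := by
    refine (measure_union_le _ _).trans_eq ?_
    rw [Real.volume_Icc, Real.volume_Icc, sub_zero, sub_sub_cancel,
      ← ENNReal.ofReal_add (by positivity) (by positivity)]
    congr 1
    ring
  rw [Measure.restrict_apply (measurableSet_lt measurable_lam measurable_const)]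
  calc volume ({k | lam k < u} ∩ cube)
      ≤ ENNReal.ofReal (√u / 2) ^ 4 := by
        refine (measure_mono hsub).trans ?_
        rw [volume_pi_pi, Finset.prod_const, Finset.card_univ, Fintype.card_fin]
        gcongr
    _ = ENNReal.ofReal (u ^ 2 / 16) := by
        rw [← ENNReal.ofReal_pow (by positivity)]
        congr 1
        nth_rewrite 2 [← Real.sq_sqrt hu]
        ring

lemma ae_lam_pos : ∀ᵐ k ∂volume.restrict cube, 0 < lam k := by
  have hlim : Tendsto (fun u : ℝ => ENNReal.ofReal (u ^ 2 / 16)) (𝓝[>] 0) (𝓝 0) := by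
    have h : Continuous fun u : ℝ => ENNReal.ofReal (u ^ 2 / 16) :=
      ENNReal.continuous_ofReal.comp (by fun_prop)
    simpa using (h.tendsto 0).mono_left nhdsWithin_le_nhds
  have hnull : volume.restrict cube {k | ¬ 0 < lam k} ≤ 0 := by
    refine ge_of_tendsto hlim ?_
    filter_upwards [self_mem_nhdsWithin] with u hu
    exact (measure_mono fun k hk => (not_lt.mp hk).trans_lt hu).trans
      (volume_lam_lt_le (le_of_lt hu))
  exact le_antisymm hnull zero_le

/-- The weight is minus the derivative of `u ↦ (u * (u + m))⁻¹`. -/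
lemma inv_mul_add_le_lintegral {m x : ℝ} (hm : 0 < m) (hx : 0 < x) (hx' : x ≤ 16) :
    ENNReal.ofReal (x * (x + m))⁻¹ ≤ ENNReal.ofReal (16 * (16 + m))⁻¹ +
      ∫⁻ u in Set.Ioc x 16, ENNReal.ofReal ((2 * u + m) / (u * (u + m)) ^ 2) := by
  have hcont : ContinuousOn (fun u : ℝ => (2 * u + m) / (u * (u + m)) ^ 2) (Set.uIcc x 16) := by
    rw [Set.uIcc_of_le hx']
    refine ContinuousOn.div (by fun_prop) (by fun_prop) fun u hu => ?_
    have : 0 < u := hx.trans_le hu.1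
    positivity
  have hint := hcont.intervalIntegrable (μ := volume)
  have hftc : ∫ u in x..16, (2 * u + m) / (u * (u + m)) ^ 2 =
      -(16 * (16 + m))⁻¹ - -(x * (x + m))⁻¹ := by
    refine intervalIntegral.integral_eq_sub_of_hasDerivAt
      (f := fun u => -(u * (u + m))⁻¹) (fun u hu => ?_) hint
    rw [Set.uIcc_of_le hx'] at hu
    have hu0 : 0 < u := hx.trans_le hu.1
    have hd : HasDerivAt (fun u : ℝ => u * (u + m)) (1 * (u + m) + u * 1) u :=
      (hasDerivAt_id u).mul ((hasDerivAt_id u).add_const m)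
    refine (hd.inv (by positivity)).neg.congr_deriv ?_
    ring
  rw [← ofReal_integral_eq_lintegral_ofReal ((intervalIntegrable_iff_integrableOn_Ioc_of_le hx').1 hint),
    ← intervalIntegral.integral_of_le hx', hftc, ← ENNReal.ofReal_add (by positivity)]
  · apply ENNReal.ofReal_le_ofReal
    linarith
  · have : (16 * (16 + m))⁻¹ ≤ (x * (x + m))⁻¹ := by gcongr
    linarith
  · filter_upwards [ae_restrict_mem measurableSet_Ioc] with u hu
    have hu0 : 0 < u := hx.trans hu.1
    simp only [Pi.zero_apply]
    positivity

lemma lintegral_inv_add {m : ℝ} (hm : 0 < m) :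
    ∫⁻ u in Set.Ioc (0 : ℝ) 16, ENNReal.ofReal (u + m)⁻¹ =
      ENNReal.ofReal (Real.log ((16 + m) / m)) := by
  have hcont : ContinuousOn (fun u : ℝ => (u + m)⁻¹) (Set.uIcc 0 16) := by
    rw [Set.uIcc_of_le (by norm_num)]
    refine ContinuousOn.inv₀ (by fun_prop) fun u hu => ?_
    linarith [hu.1]
  rw [← ofReal_integral_eq_lintegral_ofReal ((intervalIntegrable_iff_integrableOn_Ioc_of_le
      (by norm_num)).1 (hcont.intervalIntegrable (μ := volume))),
    ← intervalIntegral.integral_of_le (by norm_num),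
    intervalIntegral.integral_comp_add_right (fun u => u⁻¹), zero_add,
    integral_inv_of_pos hm (by positivity)]
  filter_upwards [ae_restrict_mem measurableSet_Ioc] with u hu
  have hu0 : 0 < u := hu.1
  simp only [Pi.zero_apply]
  positivity

lemma lintegral_inv_lam_mul_le {m : ℝ} (hm : 0 < m) :
    ∫⁻ k in cube, ENNReal.ofReal (lam k * (lam k + m))⁻¹ ≤
      ENNReal.ofReal (1 / 256 + Real.log ((16 + m) / m) / 8) := by
  set w : ℝ → ENNReal := fun u => ENNReal.ofReal ((2 * u + m) / (u * (u + m)) ^ 2) with hw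
  have hwm : Measurable w := by rw [hw]; fun_prop
  have hlog : 0 ≤ Real.log ((16 + m) / m) :=
    Real.log_nonneg ((one_le_div hm).2 (by linarith))
  have hmeas : Measurable (Function.uncurry fun (k : Fin 4 → ℝ) (u : ℝ) =>
      {k | lam k < u}.indicator (fun _ => w u) k) := by
    change Measurable fun p : (Fin 4 → ℝ) × ℝ =>
      {p : (Fin 4 → ℝ) × ℝ | lam p.1 < p.2}.indicator (fun p => w p.2) p
    exact (hwm.comp measurable_snd).indicator
      (measurableSet_lt (measurable_lam.comp measurable_fst) measurable_snd)
  have hpt : ∀ᵐ k ∂volume.restrict cube, ENNReal.ofReal (lam k * (lam k + m))⁻¹ ≤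
      ENNReal.ofReal (1 / 256) +
        ∫⁻ u in Set.Ioc (0 : ℝ) 16, {k | lam k < u}.indicator (fun _ => w u) k := by
    filter_upwards [ae_lam_pos] with k hk
    refine (inv_mul_add_le_lintegral hm hk (lam_le k)).trans (add_le_add ?_ ?_)
    · apply ENNReal.ofReal_le_ofReal
      rw [one_div]
      gcongr
      linarith
    · have hIoc : Set.Ioc (lam k) 16 ⊆ Set.Ioc 0 16 := Set.Ioc_subset_Ioc_left hk.le
      refine le_trans (setLIntegral_mono_ae' measurableSet_Ioc (ae_of_all _ fun u hu => ?_))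
        (lintegral_mono_set hIoc)
      rw [Set.indicator_of_mem (show k ∈ {k | lam k < u} from hu.1)]
  have hbound : ∀ u ∈ Set.Ioc (0 : ℝ) 16,
      ∫⁻ k in cube, {k | lam k < u}.indicator (fun _ => w u) k ≤
        ENNReal.ofReal (1 / 8) * ENNReal.ofReal (u + m)⁻¹ := by
    intro u hu
    have hu0 : 0 < u := hu.1
    rw [lintegral_indicator_const (measurableSet_lt measurable_lam measurable_const)]
    refine (mul_le_mul_right (volume_lam_lt_le hu0.le) _).trans ?_
    rw [hw, ← ENNReal.ofReal_mul (by positivity), ← ENNReal.ofReal_mul (by positivity)]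
    apply ENNReal.ofReal_le_ofReal
    have : 1 / 8 * (u + m)⁻¹ - (2 * u + m) / (u * (u + m)) ^ 2 * (u ^ 2 / 16) =
        m / (16 * (u + m) ^ 2) := by
      field_simp
      ring
    have : 0 ≤ m / (16 * (u + m) ^ 2) := by positivity
    linarith
  calc ∫⁻ k in cube, ENNReal.ofReal (lam k * (lam k + m))⁻¹
      ≤ ∫⁻ k in cube, (ENNReal.ofReal (1 / 256) +
          ∫⁻ u in Set.Ioc (0 : ℝ) 16, {k | lam k < u}.indicator (fun _ => w u) k) :=
        lintegral_mono_ae hpt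
    _ = ENNReal.ofReal (1 / 256) + ∫⁻ u in Set.Ioc (0 : ℝ) 16,
          ∫⁻ k in cube, {k | lam k < u}.indicator (fun _ => w u) k := by
        rw [lintegral_add_left measurable_const, setLIntegral_const, volume_cube, mul_one,
          lintegral_lintegral_swap hmeas.aemeasurable]
    _ ≤ ENNReal.ofReal (1 / 256) + ∫⁻ u in Set.Ioc (0 : ℝ) 16,
          ENNReal.ofReal (1 / 8) * ENNReal.ofReal (u + m)⁻¹ := by
        gcongr 1
        exact setLIntegral_mono_ae' measurableSet_Ioc (ae_of_all _ hbound)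
    _ = ENNReal.ofReal (1 / 256 + Real.log ((16 + m) / m) / 8) := by
        rw [lintegral_const_mul' _ _ ENNReal.ofReal_ne_top, lintegral_inv_add hm,
          ← ENNReal.ofReal_mul (by norm_num), ← ENNReal.ofReal_add (by norm_num) (by positivity)]
        congr 2
        ring

lemma integrableOn_inv_lam_mul {m : ℝ} (hm : 0 < m) :
    IntegrableOn (fun k => (lam k * (lam k + m))⁻¹) cube := by
  have hmeas : Measurable fun k => (lam k * (lam k + m))⁻¹ :=
    (measurable_lam.mul (measurable_lam.add_const m)).inv
  refine ⟨hmeas.aestronglyMeasurable, ?_⟩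
  rw [hasFiniteIntegral_iff_ofReal (ae_of_all _ fun k => ?_)]
  · exact (lintegral_inv_lam_mul_le hm).trans_lt ENNReal.ofReal_lt_top
  · have := lam_nonneg k
    simp only [Pi.zero_apply]
    positivity

lemma integral_inv_lam_mul_le {m : ℝ} (hm : 0 < m) :
    ∫ k in cube, (lam k * (lam k + m))⁻¹ ≤ 1 / 256 + Real.log ((16 + m) / m) / 8 := by
  have hlog : 0 ≤ Real.log ((16 + m) / m) :=
    Real.log_nonneg ((one_le_div hm).2 (by linarith))
  rw [integral_eq_lintegral_of_nonneg_ae (ae_of_all _ fun k => ?_)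
    (integrableOn_inv_lam_mul hm).aestronglyMeasurable]
  · exact ENNReal.toReal_le_of_le_ofReal (by positivity) (lintegral_inv_lam_mul_le hm)
  · have := lam_nonneg k
    simp only [Pi.zero_apply]
    positivity

lemma integrableOn_inv_lam : IntegrableOn (fun k => (lam k)⁻¹) cube := by
  refine ((integrableOn_inv_lam_mul one_pos).const_mul 17).mono'
    measurable_lam.inv.aestronglyMeasurable ?_
  filter_upwards [ae_lam_pos] with k hk
  rw [Real.norm_of_nonneg (by positivity), mul_inv, mul_left_comm]
  refine le_mul_of_one_le_right (by positivity) ?_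
  rw [← div_eq_mul_inv, one_le_div (by positivity)]
  linarith [lam_le k]

lemma integrableOn_inv_lam_add {m : ℝ} (hm : 0 < m) :
    IntegrableOn (fun k => (lam k + m)⁻¹) cube := by
  refine integrableOn_inv_lam.mono' (measurable_lam.add_const m).inv.aestronglyMeasurable ?_
  filter_upwards [ae_lam_pos] with k hk
  rw [Real.norm_of_nonneg (by positivity)]
  gcongr
  linarith

lemma integral_inv_lam_pos : 0 < ∫ k in cube, (lam k)⁻¹ := by
  have hle : ∫ _k in cube, (1 / 16 : ℝ) ≤ ∫ k in cube, (lam k)⁻¹ := by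
    refine integral_mono_ae (integrableOn_const (by simp [volume_cube])) integrableOn_inv_lam ?_
    filter_upwards [ae_lam_pos] with k hk
    rw [one_div]
    exact inv_anti₀ hk (lam_le k)
  rw [setIntegral_const, measureReal_def, volume_cube] at hle
  norm_num at hle
  linarith

lemma integral_inv_lam_sub_green {m : ℝ} (hm : 0 < m) :
    (∫ k in cube, (lam k)⁻¹) - green m = m * ∫ k in cube, (lam k * (lam k + m))⁻¹ := by
  rw [green, ← integral_sub integrableOn_inv_lam (integrableOn_inv_lam_add hm),
    ← integral_const_mul]
  refine integral_congr_ae ?_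
  filter_upwards [ae_lam_pos] with k hk
  field_simp
  ring

/-- the lattice Green function at the origin in dimension 4:
(a) `C₀(0)` is finite and positive; (b) `C₀(0) − C_{m²}(0) = O(m²(1 + log(1/m²)))`
for small `m²`. -/
theorem green_function_continuity :
    IntegrableOn (fun k => (lam k)⁻¹) cube volume ∧
    0 < (∫ k in cube, (lam k)⁻¹) ∧
    ∃ c : ℝ, 0 < c ∧
      ∀ m2 : ℝ, 0 < m2 → m2 ≤ 1 / 2 →
        0 ≤ (∫ k in cube, (lam k)⁻¹) - green m2 ∧
        (∫ k in cube, (lam k)⁻¹) - green m2 ≤ c * m2 * (1 + Real.log (1 / m2)) := by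
  refine ⟨integrableOn_inv_lam, integral_inv_lam_pos, 3, by norm_num, fun m hm hm' => ?_⟩
  rw [integral_inv_lam_sub_green hm]
  refine ⟨mul_nonneg hm.le (integral_nonneg fun k => ?_), ?_⟩
  · have := lam_nonneg k
    simp only [Pi.zero_apply]
    positivity
  · have hL : 0 ≤ Real.log (1 / m) := Real.log_nonneg ((one_le_div hm).2 (by linarith))
    have hlog : Real.log ((16 + m) / m) ≤ 16 + Real.log (1 / m) := by
      rw [div_eq_mul_one_div, Real.log_mul (by positivity) (by positivity)]
      linarith [Real.log_le_sub_one_of_pos (show 0 < 16 + m by positivity)]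
    rw [mul_comm 3 m, mul_assoc]
    gcongr
    linarith [integral_inv_lam_mul_le hm]

end Phi4
end
end
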